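/- arXiv:2508.20797 — 2 statements merged into one kernel-verified Lean document; each statement's English description precedes it below -/
import Mathlib

section
/- Let l ≥ 1 be an integer and let μ denote the normalized Haar probability measure on the unitary group U(l). Then for every real z, ∫_{U(l)} (det U)^l exp(z · Tr(U + U†)) dμ(U) = det[ I_{j−k+l}(2z) ]_{j,k=0,…,l−1} = (−1)^{l(l−1)/2} det[ I_{j+k+1}(2z) ]_{j,k=0,…,l−1}. -/
open Real MeasureTheory Matrix

/-- Modified Bessel function of the first kind,
`I_ν(x) := Σ_{k=0}^∞ (x/2)^{ν+2k}/(k! Γ(ν+k+1))`. -/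
noncomputable def besselI (ν : ℝ) (x : ℝ) : ℝ :=
  ∑' k : ℕ, (x / 2) ^ (ν + 2 * (k : ℝ)) / ((k.factorial : ℝ) * Real.Gamma (ν + (k : ℝ) + 1))

/-- The (product) measurable structure on matrices. -/
instance matrixMeasurableSpace (m n α : Type*) [MeasurableSpace α] :
    MeasurableSpace (Matrix m n α) :=
  inferInstanceAs (MeasurableSpace (m → n → α))

namespace UAvg
open Polynomial

instance borelMat (l : ℕ) : BorelSpace (Matrix (Fin l) (Fin l) ℂ) :=
  inferInstanceAs (BorelSpace (Fin l → Fin l → ℂ))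

instance borelU (l : ℕ) : BorelSpace (Matrix.unitaryGroup (Fin l) ℂ) :=
  inferInstanceAs (BorelSpace {A : Matrix (Fin l) (Fin l) ℂ // A ∈ Matrix.unitaryGroup (Fin l) ℂ})

instance scMat (l : ℕ) : SecondCountableTopology (Matrix (Fin l) (Fin l) ℂ) :=
  inferInstanceAs (SecondCountableTopology (Fin l → Fin l → ℂ))

instance scU (l : ℕ) : SecondCountableTopology (Matrix.unitaryGroup (Fin l) ℂ) :=
  Topology.IsEmbedding.subtypeVal.secondCountableTopology

instance compactU (l : ℕ) : CompactSpace (Matrix.unitaryGroup (Fin l) ℂ) := by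
  have hK : IsCompact (Set.pi Set.univ (fun _ : Fin l => Set.pi Set.univ
      (fun _ : Fin l => Metric.closedBall (0:ℂ) 1))) :=
    isCompact_univ_pi fun _ => isCompact_univ_pi fun _ => isCompact_closedBall _ _
  have hcl : IsClosed (Matrix.unitaryGroup (Fin l) ℂ : Set (Matrix (Fin l) (Fin l) ℂ)) := by
    have : (Matrix.unitaryGroup (Fin l) ℂ : Set (Matrix (Fin l) (Fin l) ℂ))
        = {A | A * star A = 1} := by
      ext A; simp [Matrix.mem_unitaryGroup_iff]
    rw [this]
    exact isClosed_eq (continuous_id.matrix_mul continuous_star) continuous_const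
  have : IsCompact (Matrix.unitaryGroup (Fin l) ℂ : Set (Matrix (Fin l) (Fin l) ℂ)) := by
    refine IsCompact.of_isClosed_subset hK hcl ?_
    intro A hA i _ j _
    simpa using entry_norm_bound_of_unitary hA i j
  exact isCompact_iff_compactSpace.mp this

lemma integrable_cont {l : ℕ} (μ : Measure (Matrix.unitaryGroup (Fin l) ℂ)) [IsProbabilityMeasure μ]
    {f : Matrix.unitaryGroup (Fin l) ℂ → ℂ} (hf : Continuous f) : Integrable f μ := by
  exact hf.integrable_of_hasCompactSupport (HasCompactSupport.of_compactSpace f)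

lemma spectral {l : ℕ} (U : Matrix.unitaryGroup (Fin l) ℂ) :
    ∃ (W : Matrix.unitaryGroup (Fin l) ℂ) (d : Fin l → ℂ),
      (U : Matrix (Fin l) (Fin l) ℂ) = W * Matrix.diagonal d * star (W : Matrix (Fin l) (Fin l) ℂ) := by
  obtain ⟨A, hA⟩ := U
  simp only
  have hA' := Matrix.mem_unitaryGroup_iff.mp hA
  have hA'' := Matrix.mem_unitaryGroup_iff'.mp hA
  -- choose c on the unit circle off the spectrum
  obtain ⟨c, hc1, hc2⟩ : ∃ c : ℂ, ‖c‖ = 1 ∧ c ∉ A.charpoly.roots.toFinset := by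
    have hinf : (Metric.sphere (0:ℂ) 1).Infinite := by
      have hinj : Function.Injective (fun n : ℕ => Complex.exp (n * Complex.I)) := by
        intro a b hab
        simp only [Complex.exp_eq_exp_iff_exists_int] at hab
        obtain ⟨n, hn⟩ := hab
        have h1 : (a:ℂ) = b + n * (2 * Real.pi) := by
          have : (a:ℂ) * Complex.I = (b + n * (2 * Real.pi)) * Complex.I := by rw [hn]; ring
          exact mul_right_cancel₀ Complex.I_ne_zero this
        have h2 : (a:ℝ) = b + n * (2 * Real.pi) := by exact_mod_cast h1
        by_cases hn0 : n = 0
        · subst hn0; simp at h2; exact h2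
        · exfalso
          have : Irrational ((2 * n : ℤ) * Real.pi) := irrational_pi.intCast_mul (by simpa using hn0)
          apply this
          refine ⟨(a - b : ℤ), ?_⟩
          push_cast; rw [h2]; ring
      refine Set.infinite_of_injective_forall_mem hinj ?_
      intro n
      simp [Complex.norm_exp]
    obtain ⟨c, hc, hc'⟩ := hinf.exists_notMem_finset A.charpoly.roots.toFinset
    exact ⟨c, by simpa using hc, hc'⟩
  set B : Matrix (Fin l) (Fin l) ℂ := c • 1 - A with hB
  have hdet : IsUnit B.det := by
    rw [isUnit_iff_ne_zero]
    intro h0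
    apply hc2
    rw [Multiset.mem_toFinset, Polynomial.mem_roots A.charpoly_monic.ne_zero, Polynomial.IsRoot,
      Matrix.eval_charpoly, Matrix.scalar_apply, ← Matrix.smul_one_eq_diagonal]
    exact h0
  have hcc : c * star c = 1 := by
    have := Complex.mul_conj c
    rw [Complex.normSq_eq_norm_sq, hc1] at this
    simpa using this
  have hcc' : star c * c = 1 := by rw [mul_comm]; exact hcc
  set P : Matrix (Fin l) (Fin l) ℂ := c • 1 + A with hP
  set H := Complex.I • (B⁻¹ * P) with hH
  have hBH : B * H = Complex.I • P := by
    rw [hH, Matrix.mul_smul, Matrix.mul_nonsing_inv_cancel_left _ _ hdet]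
  have key : B * star P + P * star B = 0 := by
    simp only [hB, hP, star_sub, star_add, star_smul, star_one, sub_mul, add_mul, mul_add, mul_sub,
      hA', mul_one, one_mul, smul_mul_assoc, mul_smul_comm]
    rw [smul_sub, smul_add, smul_smul, hcc', one_smul]
    abel
  have hherm : H.IsHermitian := by
    have hBs : IsUnit (star B).det := by
      rw [Matrix.star_eq_conjTranspose, Matrix.det_conjTranspose]; exact hdet.star
    have hsH : star H * star B = -Complex.I • star P := by
      rw [← star_mul, hBH, star_smul]; simp
    have h1 : B * H * star B = B * star H * star B := by
      rw [hBH, mul_assoc, hsH, Matrix.smul_mul, Matrix.mul_smul, ← sub_eq_zero,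
        neg_smul, sub_neg_eq_add, ← smul_add, add_comm, key, smul_zero]
    have h2 : B * H = B * star H := by
      have := congrArg (· * (star B)⁻¹) h1
      simpa [Matrix.mul_nonsing_inv_cancel_right _ _ hBs] using this
    have h3 : H = star H := by
      have := congrArg (B⁻¹ * ·) h2
      simpa [Matrix.nonsing_inv_mul_cancel_left _ _ hdet] using this
    exact h3.symm
  set W := hherm.eigenvectorUnitary with hW
  have hspec := hherm.spectral_theorem
  rw [Unitary.conjStarAlgAut_apply] at hspec
  set D : Matrix (Fin l) (Fin l) ℂ := diagonal (RCLike.ofReal ∘ hherm.eigenvalues) with hD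
  have hWs : star (W : Matrix (Fin l) (Fin l) ℂ) * W = 1 := Matrix.mem_unitaryGroup_iff'.mp W.2
  have hWs' : (W : Matrix (Fin l) (Fin l) ℂ) * star (W : Matrix (Fin l) (Fin l) ℂ) = 1 :=
    Matrix.mem_unitaryGroup_iff.mp W.2
  set V : Matrix (Fin l) (Fin l) ℂ := star (W : Matrix (Fin l) (Fin l) ℂ) * A * W with hV
  have hAV : A = W * V * star (W : Matrix (Fin l) (Fin l) ℂ) := by
    rw [hV]
    calc A = 1 * A * 1 := by simp
      _ = _ := by rw [← hWs']; noncomm_ring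
  have hne : ∀ i, ((hherm.eigenvalues i : ℂ) + Complex.I) ≠ 0 := by
    intro i h
    have := congrArg Complex.im h
    simp at this
  have hmain : V * (D + Complex.I • 1) = c • D - (Complex.I * c) • 1 := by
    have e1 : star (W : Matrix (Fin l) (Fin l) ℂ) * (B * H) * W
        = star (W : Matrix (Fin l) (Fin l) ℂ) * (Complex.I • P) * W := by rw [hBH]
    have e2 : star (W : Matrix (Fin l) (Fin l) ℂ) * (B * H) * W = c • D - V * D := by
      have : star (W : Matrix (Fin l) (Fin l) ℂ) * (B * H) * W
        = (star (W : Matrix (Fin l) (Fin l) ℂ) * B * W) * D * (star (W : Matrix (Fin l) (Fin l) ℂ) * W) := by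
        rw [hspec]; noncomm_ring
      rw [this, hWs, mul_one, hB, mul_sub, sub_mul, sub_mul, mul_smul_comm, mul_one, smul_mul_assoc,
        hWs, smul_mul_assoc, one_mul]
    have e3 : star (W : Matrix (Fin l) (Fin l) ℂ) * (Complex.I • P) * W
        = (Complex.I * c) • 1 + Complex.I • V := by
      rw [hP, mul_smul_comm, smul_mul_assoc, mul_add, add_mul, mul_smul_comm, mul_one, smul_mul_assoc,
        hWs, smul_add, smul_smul]
    rw [e2, e3] at e1
    rw [mul_add, mul_smul_comm, mul_one]
    have := e1
    rw [sub_eq_iff_eq_add] at this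
    rw [this]; abel
  have hDI : D + Complex.I • 1 = diagonal (fun i => (hherm.eigenvalues i : ℂ) + Complex.I) := by
    rw [hD, Matrix.smul_one_eq_diagonal, Matrix.diagonal_add]; rfl
  have hR : c • D - (Complex.I * c) • 1
      = diagonal (fun i => c * (hherm.eigenvalues i : ℂ) - Complex.I * c) := by
    rw [hD, Matrix.smul_one_eq_diagonal, ← Matrix.diagonal_smul, Matrix.diagonal_sub]; rfl
  refine ⟨W, fun i => (c * (hherm.eigenvalues i : ℂ) - Complex.I * c) *
    ((hherm.eigenvalues i : ℂ) + Complex.I)⁻¹, ?_⟩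
  have hVd : V = diagonal (fun i => (c * (hherm.eigenvalues i : ℂ) - Complex.I * c) *
    ((hherm.eigenvalues i : ℂ) + Complex.I)⁻¹) := by
    have := congrArg (· * diagonal (fun i => ((hherm.eigenvalues i : ℂ) + Complex.I)⁻¹)) hmain
    simp only [hDI, hR, mul_assoc, Matrix.diagonal_mul_diagonal] at this
    rw [← this]
    simp [hne]
  rw [← hVd]
  exact hAV
end UAvg

namespace UAvg

lemma entire_zero_of_freq {f : ℂ → ℂ} (hf : Differentiable ℂ f) (w : ℂ)
    (h : ∃ᶠ z in nhdsWithin w {w}ᶜ, f z = 0) (z : ℂ) : f z = 0 := by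
  have ha : AnalyticOnNhd ℂ f Set.univ := Complex.analyticOnNhd_univ_iff_differentiable.mpr hf
  have := ha.eq_of_frequently_eq (g := fun _ => 0) (analyticOnNhd_const) (z₀ := w) h
  exact congrFun this z

lemma entire_zero_of_real {f : ℂ → ℂ} (hf : Differentiable ℂ f)
    (h : ∀ x : ℝ, f x = 0) (z : ℂ) : f z = 0 := by
  refine entire_zero_of_freq hf 0 ?_ z
  have ht : Filter.Tendsto (fun n : ℕ => (((1 / ((n:ℝ) + 1) : ℝ)) : ℂ)) Filter.atTop
      (nhdsWithin (0:ℂ) {0}ᶜ) := by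
    rw [tendsto_nhdsWithin_iff]
    constructor
    · have := (Complex.continuous_ofReal.tendsto 0).comp (tendsto_one_div_add_atTop_nhds_zero_nat (𝕜 := ℝ))
      simpa [Function.comp_def] using this
    · refine Filter.Eventually.of_forall fun n => ?_
      have : ((1 / ((n:ℝ) + 1) : ℝ)) ≠ 0 := by positivity
      simpa using (Complex.ofReal_ne_zero.mpr this)
  exact ht.frequently (Filter.Frequently.of_forall fun n => h _)

lemma diff_det {l : ℕ} (g : ℂ → Matrix (Fin l) (Fin l) ℂ)
    (hg : ∀ i j, Differentiable ℂ (fun z => g z i j)) : Differentiable ℂ (fun z => (g z).det) := by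
  simp only [Matrix.det_apply]
  fun_prop

lemma diff_adj {l : ℕ} (g : ℂ → Matrix (Fin l) (Fin l) ℂ)
    (hg : ∀ i j, Differentiable ℂ (fun z => g z i j)) (i j : Fin l) :
    Differentiable ℂ (fun z => (g z).adjugate i j) := by
  simp only [Matrix.adjugate_apply]
  apply diff_det
  intro a b
  by_cases h : a = j
  · subst h; simp
  · simp only [Matrix.updateRow_ne h]; exact hg a b

open ComplexOrder in
lemma cayley_unitary {l : ℕ} (H : Matrix (Fin l) (Fin l) ℂ) (hH : H.IsHermitian) :
    (1 - Complex.I • H).det ≠ 0 ∧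
      (1 + Complex.I • H) * (1 - Complex.I • H)⁻¹ ∈ Matrix.unitaryGroup (Fin l) ℂ := by
  set P := 1 + Complex.I • H with hP
  set M := 1 - Complex.I • H with hM
  have hPM : P * M = 1 + H * H := by
    simp only [hP, hM, add_mul, mul_sub, one_mul, mul_one, smul_mul_assoc, mul_smul_comm]
    rw [smul_add, smul_smul, Complex.I_mul_I, neg_one_smul]
    abel
  have hMP : M * P = 1 + H * H := by
    simp only [hP, hM, sub_mul, mul_add, one_mul, mul_one, smul_mul_assoc, mul_smul_comm]
    rw [smul_sub, smul_smul, Complex.I_mul_I, neg_one_smul]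
    abel
  have hpos : (1 + H * H).PosDef := by
    refine Matrix.PosDef.one.add_posSemidef ?_
    have := Matrix.posSemidef_conjTranspose_mul_self H
    rwa [hH.eq] at this
  have hdet : (1 + H * H).det ≠ 0 := hpos.det_pos.ne'
  have hd := hdet
  rw [← hPM, Matrix.det_mul] at hd
  have hPd : IsUnit P.det := (left_ne_zero_of_mul hd).isUnit
  have hMd : IsUnit M.det := (right_ne_zero_of_mul hd).isUnit
  refine ⟨hMd.ne_zero, ?_⟩
  rw [Matrix.mem_unitaryGroup_iff]
  have hsP : star P = M := by
    rw [hP, hM, star_add, star_smul, Matrix.star_eq_conjTranspose H, hH.eq]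
    simp [sub_eq_add_neg]
  have hsM : Mᴴ = P := by rw [← hsP, ← Matrix.star_eq_conjTranspose, star_star]
  rw [star_mul, Matrix.star_eq_conjTranspose M⁻¹, Matrix.conjTranspose_nonsing_inv, hsM, hsP]
  calc P * M⁻¹ * (P⁻¹ * M) = P * (M⁻¹ * P⁻¹) * M := by noncomm_ring
    _ = P * (P⁻¹ * M⁻¹) * M := by
        rw [← Matrix.mul_inv_rev, ← Matrix.mul_inv_rev, hPM, hMP]
    _ = (P * P⁻¹) * (M⁻¹ * M) := by noncomm_ring
    _ = 1 := by rw [Matrix.mul_nonsing_inv _ hPd, Matrix.nonsing_inv_mul _ hMd, one_mul]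

lemma vanish_of_unitary {l : ℕ} (f : Matrix (Fin l) (Fin l) ℂ → ℂ) (d : ℕ)
    (hhom : ∀ (c : ℂ) X, f (c • X) = c ^ d * f X)
    (hdiff : ∀ g : ℂ → Matrix (Fin l) (Fin l) ℂ, (∀ i j, Differentiable ℂ (fun z => g z i j)) →
      Differentiable ℂ (fun z => f (g z)))
    (h0 : ∀ W ∈ Matrix.unitaryGroup (Fin l) ℂ, f W = 0) (X : Matrix (Fin l) (Fin l) ℂ) : f X = 0 := by
  let q : Matrix (Fin l) (Fin l) ℂ → Matrix (Fin l) (Fin l) ℂ :=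
    fun K => (1 + Complex.I • K) * (1 - Complex.I • K).adjugate
  have s1 : ∀ H : Matrix (Fin l) (Fin l) ℂ, H.IsHermitian → f (q H) = 0 := by
    intro H hH
    obtain ⟨hd, hu⟩ := cayley_unitary H hH
    have : q H = (1 - Complex.I • H).det • ((1 + Complex.I • H) * (1 - Complex.I • H)⁻¹) := by
      simp only [q]
      rw [Matrix.inv_def, Ring.inverse_eq_inv', Matrix.mul_smul, smul_smul, mul_inv_cancel₀ hd, one_smul]
    rw [this, hhom, h0 _ hu, mul_zero]
  have s2 : ∀ A B : Matrix (Fin l) (Fin l) ℂ, A.IsHermitian → B.IsHermitian → ∀ z : ℂ,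
      f (q (A + z • B)) = 0 := by
    intro A B hA hB
    apply entire_zero_of_real
    · apply hdiff
      intro i j
      simp only [q, Matrix.mul_apply]
      have hadj : ∀ a b, Differentiable ℂ (fun z : ℂ => (1 - Complex.I • (A + z • B)).adjugate a b) := by
        apply diff_adj
        intro i j
        simp only [Matrix.sub_apply, Matrix.smul_apply, Matrix.add_apply, smul_eq_mul]
        fun_prop
      simp only [Matrix.smul_apply, Matrix.add_apply, smul_eq_mul]
      fun_prop
    · intro x
      apply s1
      refine hA.add ?_
      rw [Matrix.IsHermitian, Matrix.conjTranspose_smul, hB.eq]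
      simp
  have s3 : ∀ K, f (q K) = 0 := by
    intro K
    have := s2 (realPart K : Matrix (Fin l) (Fin l) ℂ) (imaginaryPart K : Matrix (Fin l) (Fin l) ℂ)
      (realPart K).2 (imaginaryPart K).2 Complex.I
    rwa [realPart_add_I_smul_imaginaryPart] at this
  have s4 : ∀ X : Matrix (Fin l) (Fin l) ℂ, (X + 1).det ≠ 0 → f X = 0 := by
    intro X hX
    have hu : IsUnit (X + 1).det := hX.isUnit
    let K := (-Complex.I) • ((X - 1) * (X + 1)⁻¹)
    have hIK : Complex.I • K = (X - 1) * (X + 1)⁻¹ := by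
      simp only [K, smul_smul]; simp
    have h1 : (1 : Matrix (Fin l) (Fin l) ℂ) = (X + 1) * (X + 1)⁻¹ := (Matrix.mul_nonsing_inv _ hu).symm
    have hm : 1 - Complex.I • K = (2:ℂ) • (X + 1)⁻¹ := by
      rw [hIK]; nth_rewrite 1 [h1]
      rw [← sub_mul, two_smul]; noncomm_ring
    have hp : 1 + Complex.I • K = X * (1 - Complex.I • K) := by
      rw [hm, hIK]; nth_rewrite 1 [h1]
      rw [← add_mul, mul_smul_comm, two_smul]; noncomm_ring
    have hd : (1 - Complex.I • K).det ≠ 0 := by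
      rw [hm, Matrix.det_smul]
      refine mul_ne_zero (pow_ne_zero _ two_ne_zero) ?_
      rw [Matrix.det_nonsing_inv, Ring.inverse_eq_inv']
      exact inv_ne_zero hX
    have h3 := s3 K
    have hq : q K = (1 - Complex.I • K).det • X := by
      simp only [q]
      rw [hp, mul_assoc, Matrix.mul_adjugate, Matrix.mul_smul, mul_one]
    rw [hq, hhom] at h3
    exact (mul_eq_zero.mp h3).resolve_left (pow_ne_zero _ hd)
  have s5 : ∀ z : ℂ, f (1 + z • (X - 1)) = 0 := by
    have hent : ∀ i j, Differentiable ℂ (fun z : ℂ => (1 + z • (X - 1)) i j) := by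
      intro i j
      simp only [Matrix.smul_apply, Matrix.add_apply, smul_eq_mul]
      fun_prop
    apply entire_zero_of_freq (w := 0)
    · exact hdiff _ hent
    · apply Filter.Eventually.frequently
      apply Filter.Eventually.filter_mono nhdsWithin_le_nhds
      have hc : Continuous (fun z : ℂ => (1 + z • (X - 1) + 1).det) := by
        apply Differentiable.continuous (𝕜 := ℂ)
        apply diff_det
        intro i j
        have := hent i j
        simp only [Matrix.add_apply _ 1 ]
        exact this.add_const _
      have : (fun z : ℂ => (1 + z • (X - 1) + 1).det) 0 ≠ 0 := by
        have : (1 + (0:ℂ) • (X - 1) + 1 : Matrix (Fin l) (Fin l) ℂ) = (2:ℂ) • 1 := by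
          rw [zero_smul, two_smul]; simp
        simp only [this, Matrix.det_smul]
        simp
      filter_upwards [hc.continuousAt.eventually_ne this] with z hz
      exact s4 _ hz
  simpa using s5 1

lemma cont_entry {l : ℕ} (i j : Fin l) :
    Continuous (fun U : Matrix.unitaryGroup (Fin l) ℂ => (U : Matrix (Fin l) (Fin l) ℂ) i j) :=
  continuous_subtype_val.matrix_elem i j

lemma cont_det {l : ℕ} :
    Continuous (fun U : Matrix.unitaryGroup (Fin l) ℂ => (U : Matrix (Fin l) (Fin l) ℂ).det) :=
  continuous_subtype_val.matrix_det

/-- integrals of rep-like polynomials -/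
lemma inv_integral {l : ℕ} (μ : Measure (Matrix.unitaryGroup (Fin l) ℂ)) [μ.IsHaarMeasure]
    [IsProbabilityMeasure μ] (m : ℕ) (α : Fin l → ℕ) (hα : ∃ r, α r ≠ m)
    (Y X : Matrix (Fin l) (Fin l) ℂ) :
    ∫ U : Matrix.unitaryGroup (Fin l) ℂ, (∏ r, ((Y * (U : Matrix (Fin l) (Fin l) ℂ) * X) r r) ^ α r) *
      (star (Matrix.det (U : Matrix (Fin l) (Fin l) ℂ))) ^ m ∂μ = 0 := by
  have hunit : ∀ W : Matrix.unitaryGroup (Fin l) ℂ,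
      (W : Matrix (Fin l) (Fin l) ℂ).det * star (W : Matrix (Fin l) (Fin l) ℂ).det = 1 := by
    intro W
    have := Matrix.mem_unitaryGroup_iff.mp W.2
    have := congrArg Matrix.det this
    rwa [Matrix.det_mul, Matrix.star_eq_conjTranspose, Matrix.det_conjTranspose, Matrix.det_one] at this
  let Φ : Matrix.unitaryGroup (Fin l) ℂ → ℂ := fun U =>
    (∏ r, (((U : Matrix (Fin l) (Fin l) ℂ) * X) r r) ^ α r) *
      (star (Matrix.det (U : Matrix (Fin l) (Fin l) ℂ))) ^ m
  have hΦ0 : ∫ U, Φ U ∂μ = 0 := by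
    obtain ⟨r, hr⟩ := hα
    -- diagonal unitary
    let t : Fin l → ℂ := fun i => if i = r then Complex.exp Complex.I else 1
    have ht : ∀ i, t i * star (t i) = 1 := by
      intro i
      by_cases h : i = r
      · simp only [t, h, if_true]
        have := Complex.mul_conj (Complex.exp Complex.I)
        rw [Complex.normSq_eq_norm_sq, Complex.norm_exp] at this
        simpa using this
      · simp [t, h]
    let T : Matrix.unitaryGroup (Fin l) ℂ := ⟨Matrix.diagonal t, by
      rw [Matrix.mem_unitaryGroup_iff, Matrix.star_eq_conjTranspose, Matrix.diagonal_conjTranspose,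
        Matrix.diagonal_mul_diagonal]
      rw [← Matrix.diagonal_one]
      congr 1
      funext i
      exact ht i⟩
    have hT : ∀ U, Φ (T * U) = (Complex.exp Complex.I) ^ α r * (star (Complex.exp Complex.I)) ^ m * Φ U := by
      intro U
      simp only [Φ, T, Submonoid.coe_mul, mul_assoc, Matrix.diagonal_mul, Matrix.det_mul, Matrix.det_diagonal,
        star_mul', mul_pow, Finset.prod_mul_distrib]
      have e1 : ∏ i, t i ^ α i = (Complex.exp Complex.I) ^ α r := by
        rw [Finset.prod_eq_single r]
        · simp [t]
        · intro b _ hb; simp [t, hb]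
        · simp
      have e2 : ∏ i, t i = (Complex.exp Complex.I) := by simp [t]
      rw [e1, e2]; ring
    have h1 : ∫ U, Φ (T * U) ∂μ = ∫ U, Φ U ∂μ := integral_mul_left_eq_self Φ T
    simp only [hT] at h1
    rw [integral_const_mul] at h1
    by_contra hne
    have h2 : (Complex.exp Complex.I) ^ α r * (star (Complex.exp Complex.I)) ^ m = 1 := by
      have : ((Complex.exp Complex.I) ^ α r * (star (Complex.exp Complex.I)) ^ m - 1) * ∫ U, Φ U ∂μ = 0 := by
        rw [sub_mul, h1]; ring
      exact sub_eq_zero.mp ((mul_eq_zero.mp this).resolve_right hne)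
    have hst : star (Complex.exp Complex.I) = Complex.exp (-Complex.I) := by
      have := (Complex.exp_conj Complex.I).symm
      simpa using this
    rw [hst, ← Complex.exp_nat_mul, ← Complex.exp_nat_mul, ← Complex.exp_add, Complex.exp_eq_one_iff] at h2
    obtain ⟨n, hn⟩ := h2
    have h1 : ((α r : ℂ) - m) = n * (2 * Real.pi) := by
      have : ((α r : ℂ) - m) * Complex.I = (n * (2 * Real.pi)) * Complex.I := by
        rw [mul_assoc (n:ℂ), ← hn]; ring
      exact mul_right_cancel₀ Complex.I_ne_zero this
    have h2 : ((α r : ℝ) - m) = n * (2 * Real.pi) := by exact_mod_cast h1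
    by_cases hn0 : n = 0
    · subst hn0
      simp at h2
      rw [sub_eq_zero] at h2
      exact hr (by exact_mod_cast h2)
    · have : Irrational ((2 * n : ℤ) * Real.pi) := irrational_pi.intCast_mul (by simpa using hn0)
      apply this
      refine ⟨((α r : ℤ) - m : ℤ), ?_⟩
      push_cast; rw [h2]; ring
  refine vanish_of_unitary (fun Y => ∫ U : Matrix.unitaryGroup (Fin l) ℂ,
    (∏ r, ((Y * (U : Matrix (Fin l) (Fin l) ℂ) * X) r r) ^ α r) *
      (star (Matrix.det (U : Matrix (Fin l) (Fin l) ℂ))) ^ m ∂μ) (∑ r, α r) ?_ ?_ ?_ Y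
  · intro c Y
    simp only [Matrix.smul_mul, Matrix.smul_apply, smul_eq_mul, mul_pow, Finset.prod_mul_distrib]
    simp only [mul_assoc, integral_const_mul, Finset.prod_pow_eq_pow_sum]
  · intro g hg
    have hexp : ∀ Y : Matrix (Fin l) (Fin l) ℂ, (∫ U : Matrix.unitaryGroup (Fin l) ℂ,
        (∏ r, ((Y * (U : Matrix (Fin l) (Fin l) ℂ) * X) r r) ^ α r) *
        (star (Matrix.det (U : Matrix (Fin l) (Fin l) ℂ))) ^ m ∂μ)
        = ∑ J : (s : (Σ r : Fin l, Fin (α r))) → Fin l, (∏ s : (Σ r : Fin l, Fin (α r)), Y s.1 (J s)) *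
          ∫ U : Matrix.unitaryGroup (Fin l) ℂ,
            (∏ s : (Σ r : Fin l, Fin (α r)), ((U : Matrix (Fin l) (Fin l) ℂ) * X) (J s) s.1) *
            (star (Matrix.det (U : Matrix (Fin l) (Fin l) ℂ))) ^ m ∂μ := by
      intro Y
      simp only [← integral_const_mul]
      rw [← integral_finsetSum]
      · congr 1
        funext U
        have : ∏ r, ((Y * (U : Matrix (Fin l) (Fin l) ℂ) * X) r r) ^ α r
          = ∏ s : (Σ r : Fin l, Fin (α r)), ∑ j, Y s.1 j * ((U : Matrix (Fin l) (Fin l) ℂ) * X) j s.1 := by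
          rw [Fintype.prod_sigma]
          refine Finset.prod_congr rfl fun r _ => ?_
          simp only [Finset.prod_const, Finset.card_univ, Fintype.card_fin]
          rw [mul_assoc Y, Matrix.mul_apply]
        rw [this, Finset.prod_univ_sum, Finset.sum_mul]
        simp only [Fintype.piFinset_univ, Finset.prod_mul_distrib, mul_assoc]
      · intro J _
        apply integrable_cont
        simp only [Matrix.mul_apply]
        have h1 := @cont_entry l
        have h2 := @cont_det l
        have h3 : Continuous fun U : Matrix.unitaryGroup (Fin l) ℂ =>
          (star (Matrix.det (U : Matrix (Fin l) (Fin l) ℂ))) ^ m := (h2.star).pow m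
        refine continuous_const.mul (Continuous.mul ?_ h3)
        exact continuous_finsetProd _ fun s _ => continuous_finsetSum _ fun j _ =>
          (h1 _ _).mul continuous_const
    simp only [hexp]
    fun_prop
  · intro W hW
    let W' : Matrix.unitaryGroup (Fin l) ℂ := ⟨W, hW⟩
    have : ∀ U : Matrix.unitaryGroup (Fin l) ℂ,
      (∏ r, ((W * (U : Matrix (Fin l) (Fin l) ℂ) * X) r r) ^ α r) *
      (star (Matrix.det (U : Matrix (Fin l) (Fin l) ℂ))) ^ m = W.det ^ m * Φ (W' * U) := by
      intro U
      simp only [Φ, W', Submonoid.coe_mul, Matrix.det_mul, star_mul', mul_pow]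
      have := hunit W'
      calc _ = (W.det * star W.det) ^ m * ((∏ r, ((W * (U : Matrix (Fin l) (Fin l) ℂ) * X) r r) ^ α r) *
          (star (Matrix.det (U : Matrix (Fin l) (Fin l) ℂ))) ^ m) := by
            rw [show W.det * star W.det = 1 from this]; simp
        _ = _ := by rw [mul_pow]; ring
    simp only [this, integral_const_mul]
    rw [integral_mul_left_eq_self Φ W', hΦ0, mul_zero]
end UAvg

namespace UAvg

/-- the quadratic form `v† A v` -/
noncomputable def qf {l : ℕ} (A : Matrix (Fin l) (Fin l) ℂ) (v : Fin l → ℂ) : ℂ :=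
  star v ⬝ᵥ (A *ᵥ v)

/-- Gaussian weight -/
noncomputable def gw {l : ℕ} (v : Fin l → ℂ) : ℂ := ((Real.exp (-∑ i, ‖v i‖ ^ 2) : ℝ) : ℂ)

/-- complete homogeneous symmetric function of the eigenvalues, as a Gaussian average -/
noncomputable def hG {l : ℕ} (n : ℕ) (A : Matrix (Fin l) (Fin l) ℂ) : ℂ :=
  ((n.factorial : ℂ) * (Real.pi : ℂ) ^ l)⁻¹ * ∫ v : Fin l → ℂ, qf A v ^ n * gw v

lemma qf_one {l : ℕ} (v : Fin l → ℂ) : qf 1 v = ((∑ i, ‖v i‖ ^ 2 : ℝ) : ℂ) := by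
  simp only [qf, Matrix.one_mulVec, dotProduct, Pi.star_apply]
  push_cast
  refine Finset.sum_congr rfl fun i _ => ?_
  exact Complex.conj_mul' (v i)

lemma gw_eq {l : ℕ} (v : Fin l → ℂ) : gw v = Complex.exp (- qf 1 v) := by
  rw [qf_one, gw]; push_cast; rfl

lemma qf_conj {l : ℕ} (W A : Matrix (Fin l) (Fin l) ℂ) (v : Fin l → ℂ) :
    qf (W * A * star W) v = qf A (star W *ᵥ v) := by
  simp only [qf, ← Matrix.mulVec_mulVec, Matrix.star_mulVec, Matrix.star_eq_conjTranspose,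
    Matrix.conjTranspose_conjTranspose, Matrix.dotProduct_mulVec]

lemma gw_conj {l : ℕ} (W : Matrix.unitaryGroup (Fin l) ℂ) (v : Fin l → ℂ) :
    gw (star (W : Matrix (Fin l) (Fin l) ℂ) *ᵥ v) = gw v := by
  rw [gw_eq, gw_eq, ← qf_conj, mul_one, Matrix.mem_unitaryGroup_iff.mp W.2]

lemma cont_qf {l : ℕ} (A : Matrix (Fin l) (Fin l) ℂ) : Continuous (qf A) := by
  unfold qf; simp only [dotProduct, Matrix.mulVec, Pi.star_apply]; fun_prop

lemma cont_gw {l : ℕ} : Continuous (gw (l := l)) := by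
  unfold gw; fun_prop

lemma integral_unitary {l : ℕ} (W : Matrix.unitaryGroup (Fin l) ℂ) (F : (Fin l → ℂ) → ℂ)
    (hF : Continuous F) :
    ∫ v, F (star (W : Matrix (Fin l) (Fin l) ℂ) *ᵥ v) = ∫ v, F v := by
  let f : (Fin l → ℂ) →ₗ[ℝ] (Fin l → ℂ) :=
    (Matrix.toLin' (star (W : Matrix (Fin l) (Fin l) ℂ))).restrictScalars ℝ
  have hdet : LinearMap.det f = 1 := by
    simp only [f]
    rw [LinearMap.det_restrictScalars, LinearMap.det_toLin', Algebra.norm_complex_apply,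
      Matrix.star_eq_conjTranspose, Matrix.det_conjTranspose]
    have := congrArg Matrix.det (Matrix.mem_unitaryGroup_iff.mp W.2)
    rw [Matrix.det_mul, Matrix.star_eq_conjTranspose, Matrix.det_conjTranspose, Matrix.det_one] at this
    have h2 := Complex.mul_conj (W : Matrix (Fin l) (Fin l) ℂ).det
    rw [starRingEnd_apply, this] at h2
    have h3 : Complex.normSq (W : Matrix (Fin l) (Fin l) ℂ).det = 1 := by exact_mod_cast h2.symm
    rw [← starRingEnd_apply, Complex.normSq_conj, h3]
  have hmap := Measure.map_linearMap_addHaar_eq_smul_addHaar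
    (volume : Measure (Fin l → ℂ)) (f := f) (by rw [hdet]; exact one_ne_zero)
  rw [hdet] at hmap
  simp at hmap
  have hfc : Continuous f := f.continuous_of_finiteDimensional
  have := integral_map (μ := (volume : Measure (Fin l → ℂ))) hfc.measurable.aemeasurable
    (f := F) (hF.aestronglyMeasurable)
  rw [hmap] at this
  rw [this]
  rfl

lemma hG_conj {l : ℕ} (n : ℕ) (W : Matrix.unitaryGroup (Fin l) ℂ) (A : Matrix (Fin l) (Fin l) ℂ) :
    hG n ((W : Matrix (Fin l) (Fin l) ℂ) * A * star (W : Matrix (Fin l) (Fin l) ℂ)) = hG n A := by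
  unfold hG
  congr 1
  rw [← integral_unitary W (fun v => qf A v ^ n * gw v) (((cont_qf A).pow n).mul cont_gw)]
  congr 1
  funext v
  rw [qf_conj, gw_conj]

lemma moment (k : ℕ) : ∫ z : ℂ, ‖z‖ ^ (2 * k) * Real.exp (-‖z‖ ^ 2) = Real.pi * k.factorial := by
  have := Complex.integral_rpow_mul_exp_neg_rpow (p := 2) (q := (2 * k : ℕ)) (by norm_num)
    (by have : (0:ℝ) ≤ ((2 * k : ℕ) : ℝ) := Nat.cast_nonneg _
        linarith)
  simp only [Real.rpow_natCast, Real.rpow_two] at this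
  rw [this]
  have h2 : (((2 * k : ℕ) : ℝ) + 2) / 2 = (k : ℝ) + 1 := by push_cast; ring
  rw [h2, Real.Gamma_nat_eq_factorial]; ring

lemma moment_c (c : ℂ) (k : ℕ) :
    Integrable (fun z : ℂ => (c * ((‖z‖ ^ 2 : ℝ) : ℂ)) ^ k * ((Real.exp (-‖z‖ ^ 2) : ℝ) : ℂ)) ∧
    ∫ z : ℂ, (c * ((‖z‖ ^ 2 : ℝ) : ℂ)) ^ k * ((Real.exp (-‖z‖ ^ 2) : ℝ) : ℂ)
      = c ^ k * (Real.pi * k.factorial) := by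
  have he : (fun z : ℂ => (c * ((‖z‖ ^ 2 : ℝ) : ℂ)) ^ k * ((Real.exp (-‖z‖ ^ 2) : ℝ) : ℂ))
      = fun z => c ^ k * ((‖z‖ ^ (2 * k) * Real.exp (-‖z‖ ^ 2) : ℝ) : ℂ) := by
    funext z; push_cast; rw [mul_pow, pow_mul]; ring
  rw [he]
  have hi : Integrable (fun z : ℂ => ‖z‖ ^ (2 * k) * Real.exp (-‖z‖ ^ 2)) := by
    apply Integrable.of_integral_ne_zero
    rw [moment]; positivity
  refine ⟨hi.ofReal.const_mul _, ?_⟩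
  rw [integral_const_mul, integral_complex_ofReal, moment]; push_cast; rfl

lemma qf_diag {l : ℕ} (d : Fin l → ℂ) (v : Fin l → ℂ) :
    qf (Matrix.diagonal d) v = ∑ i, d i * ((‖v i‖ ^ 2 : ℝ) : ℂ) := by
  simp only [qf, dotProduct, Matrix.mulVec_diagonal, Pi.star_apply]
  refine Finset.sum_congr rfl fun i _ => ?_
  have := Complex.conj_mul' (v i)
  push_cast
  rw [← this, starRingEnd_apply]; ring

lemma diag_expand {l : ℕ} (d : Fin l → ℂ) (n : ℕ) (v : Fin l → ℂ) :
    qf (Matrix.diagonal d) v ^ n * gw v = ∑ k ∈ Finset.piAntidiag Finset.univ n,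
      (Nat.multinomial Finset.univ k : ℂ) *
        ∏ i, ((d i * ((‖v i‖ ^ 2 : ℝ) : ℂ)) ^ k i * ((Real.exp (-‖v i‖ ^ 2) : ℝ) : ℂ)) := by
  rw [qf_diag, Finset.sum_pow_eq_sum_piAntidiag, Finset.sum_mul]
  refine Finset.sum_congr rfl fun k _ => ?_
  rw [mul_assoc, Finset.prod_mul_distrib]
  congr 2
  rw [gw, ← Finset.sum_neg_distrib, Real.exp_sum]
  push_cast; rfl

lemma diag_term {l : ℕ} (d : Fin l → ℂ) (k : Fin l → ℕ) :
    Integrable (fun v : Fin l → ℂ => (Nat.multinomial Finset.univ k : ℂ) *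
        ∏ i, ((d i * ((‖v i‖ ^ 2 : ℝ) : ℂ)) ^ k i * ((Real.exp (-‖v i‖ ^ 2) : ℝ) : ℂ))) := by
  refine Integrable.const_mul ?_ _
  exact Integrable.fintype_prod_dep (μ := fun _ : Fin l => (volume : Measure ℂ))
    (f := fun i z => (d i * ((‖z‖ ^ 2 : ℝ) : ℂ)) ^ k i * ((Real.exp (-‖z‖ ^ 2) : ℝ) : ℂ))
    (fun i => (moment_c (d i) (k i)).1)

lemma diag_integrable {l : ℕ} (d : Fin l → ℂ) (n : ℕ) :
    Integrable (fun v : Fin l → ℂ => qf (Matrix.diagonal d) v ^ n * gw v) := by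
  simp only [diag_expand]
  exact integrable_finsetSum _ fun k _ => diag_term d k

lemma hG_diag {l : ℕ} (d : Fin l → ℂ) (n : ℕ) :
    hG n (Matrix.diagonal d) = ∑ k ∈ Finset.piAntidiag Finset.univ n, ∏ i, d i ^ k i := by
  unfold hG
  simp only [diag_expand]
  rw [integral_finsetSum _ fun k _ => diag_term d k, Finset.mul_sum]
  refine Finset.sum_congr rfl fun k hk => ?_
  rw [integral_const_mul, integral_fintype_prod_volume_eq_prod
    (f := fun i z => (d i * ((‖z‖ ^ 2 : ℝ) : ℂ)) ^ k i * ((Real.exp (-‖z‖ ^ 2) : ℝ) : ℂ))]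
  simp only [(moment_c _ _).2, Finset.prod_mul_distrib]
  have hs : ∑ i, k i = n := by simpa using (Finset.mem_piAntidiag.mp hk).1
  have := Nat.multinomial_spec Finset.univ k
  rw [hs] at this
  have h2 : ((n.factorial : ℕ) : ℂ) = (∏ i, ((k i).factorial : ℂ)) * (Nat.multinomial Finset.univ k : ℂ) := by
    rw [← this]; push_cast; rfl
  have hn : ((n.factorial : ℕ) : ℂ) ≠ 0 := by exact_mod_cast n.factorial_ne_zero
  have hpi : (Real.pi : ℂ) ≠ 0 := by exact_mod_cast Real.pi_ne_zero
  simp only [Finset.prod_const, Finset.card_univ, Fintype.card_fin]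
  rw [inv_mul_eq_iff_eq_mul₀ (by positivity), h2]
  ring

lemma hG_diag_coeff {l : ℕ} (d : Fin l → ℂ) (n : ℕ) :
    hG n (Matrix.diagonal d) = PowerSeries.coeff n (∏ i, PowerSeries.mk (fun k => d i ^ k)) := by
  rw [hG_diag, PowerSeries.coeff_prod]
  simp only [PowerSeries.coeff_mk]
  refine Finset.sum_bij' (fun k _ => Finsupp.equivFunOnFinite.symm k) (fun k _ => ⇑k) ?_ ?_ ?_ ?_ ?_
  · intro k hk
    simp only [Finset.mem_piAntidiag, Finset.mem_finsuppAntidiag] at hk ⊢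
    simpa using hk.1
  · intro k hk
    simp only [Finset.mem_piAntidiag, Finset.mem_finsuppAntidiag] at hk ⊢
    simpa using hk.1
  · intro k _; rfl
  · intro k _; ext; rfl
  · intro k _; rfl

/-- generating function -/
lemma hG_gen {l : ℕ} (d : Fin l → ℂ) :
    PowerSeries.mk (fun n => hG n (Matrix.diagonal d)) *
      ∏ i, (1 - PowerSeries.C (d i) * PowerSeries.X) = 1 := by
  have h1 : PowerSeries.mk (fun n => hG n (Matrix.diagonal d)) = ∏ i, PowerSeries.mk (fun k => d i ^ k) := by
    ext n; rw [PowerSeries.coeff_mk, hG_diag_coeff]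
  rw [h1, ← Finset.prod_mul_distrib]
  apply Finset.prod_eq_one
  intro i _
  ext n
  rw [mul_sub, mul_one, map_sub, ← mul_assoc]
  cases n with
  | zero => simp
  | succ n => 
    rw [PowerSeries.coeff_succ_mul_X, PowerSeries.coeff_mul_C, PowerSeries.coeff_mk, PowerSeries.coeff_mk]
    simp [pow_succ, PowerSeries.coeff_one]

lemma norm_qf_le {l : ℕ} (U : Matrix.unitaryGroup (Fin l) ℂ) (v : Fin l → ℂ) :
    ‖qf (U : Matrix (Fin l) (Fin l) ℂ) v‖ ≤ ∑ i, ‖v i‖ ^ 2 := by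
  have hn : ∀ w : Fin l → ℂ, ‖WithLp.toLp 2 w‖ ^ 2 = ∑ i, ‖w i‖ ^ 2 := by
    intro w; rw [EuclideanSpace.norm_sq_eq]
  have h1 : qf (U : Matrix (Fin l) (Fin l) ℂ) v
      = inner ℂ (WithLp.toLp 2 v) (WithLp.toLp 2 ((U : Matrix (Fin l) (Fin l) ℂ) *ᵥ v)) := by
    simp [qf, dotProduct, mul_comm, PiLp.inner_apply]
  have h2 : ∑ i, ‖((U : Matrix (Fin l) (Fin l) ℂ) *ᵥ v) i‖ ^ 2 = ∑ i, ‖v i‖ ^ 2 := by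
    have := qf_one ((U : Matrix (Fin l) (Fin l) ℂ) *ᵥ v)
    have h3 := qf_conj (star (U : Matrix (Fin l) (Fin l) ℂ)) 1 v
    rw [star_star, mul_one, Matrix.mem_unitaryGroup_iff'.mp U.2, qf_one, qf_one] at h3
    exact_mod_cast h3.symm
  rw [h1]
  refine (norm_inner_le_norm _ _).trans ?_
  rw [← hn v] at h2 ⊢
  rw [← hn] at h2
  have h4 : ‖WithLp.toLp 2 ((U : Matrix (Fin l) (Fin l) ℂ) *ᵥ v)‖ = ‖WithLp.toLp 2 v‖ := by
    exact (pow_left_inj₀ (norm_nonneg _) (norm_nonneg _) two_ne_zero).mp h2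
  rw [h4, sq]
end UAvg

namespace UAvg

/-- integrand for the Fubini argument -/
noncomputable def Phi {l : ℕ} (m : ℕ) (α : Fin l → ℕ) (U : Matrix.unitaryGroup (Fin l) ℂ)
    (V : Fin l → Fin l → ℂ) : ℂ :=
  (∏ r, (qf (U : Matrix (Fin l) (Fin l) ℂ) (V r) ^ α r * gw (V r))) *
    (star (Matrix.det (U : Matrix (Fin l) (Fin l) ℂ))) ^ m

lemma norm_det_unitary {l : ℕ} (U : Matrix.unitaryGroup (Fin l) ℂ) :
    ‖Matrix.det (U : Matrix (Fin l) (Fin l) ℂ)‖ = 1 := by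
  have := congrArg Matrix.det (Matrix.mem_unitaryGroup_iff.mp U.2)
  rw [Matrix.det_mul, Matrix.star_eq_conjTranspose, Matrix.det_conjTranspose, Matrix.det_one] at this
  have h := congrArg norm this
  rw [norm_mul, norm_star, norm_one] at h
  nlinarith [norm_nonneg (Matrix.det (U : Matrix (Fin l) (Fin l) ℂ))]

lemma norm_gw {l : ℕ} (v : Fin l → ℂ) : ‖gw v‖ = Real.exp (-∑ i, ‖v i‖ ^ 2) := by
  rw [gw, Complex.norm_real, Real.norm_of_nonneg (Real.exp_pos _).le]

lemma cont_Phi {l : ℕ} (m : ℕ) (α : Fin l → ℕ) :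
    Continuous (fun p : Matrix.unitaryGroup (Fin l) ℂ × (Fin l → Fin l → ℂ) => Phi m α p.1 p.2) := by
  unfold Phi
  have hd : Continuous (fun p : Matrix.unitaryGroup (Fin l) ℂ × (Fin l → Fin l → ℂ) =>
      (star (Matrix.det (p.1 : Matrix (Fin l) (Fin l) ℂ))) ^ m) :=
    ((cont_det.comp continuous_fst).star).pow m
  refine Continuous.mul (continuous_finsetProd _ fun r _ => ?_) hd
  have hv : ∀ i, Continuous (fun p : Matrix.unitaryGroup (Fin l) ℂ × (Fin l → Fin l → ℂ) => p.2 r i) := by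
    intro i; fun_prop
  have he : ∀ i j, Continuous (fun p : Matrix.unitaryGroup (Fin l) ℂ × (Fin l → Fin l → ℂ) =>
      (p.1 : Matrix (Fin l) (Fin l) ℂ) i j) := fun i j => (cont_entry i j).comp continuous_fst
  refine Continuous.mul (Continuous.pow ?_ _) (cont_gw.comp (by fun_prop))
  simp only [qf, dotProduct, Matrix.mulVec, Pi.star_apply]
  refine continuous_finsetSum _ fun i _ => ((hv i).star).mul (continuous_finsetSum _ fun j _ => (he i j).mul (hv j))

lemma int_Phi {l : ℕ} (μ : Measure (Matrix.unitaryGroup (Fin l) ℂ)) [IsProbabilityMeasure μ]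
    (m : ℕ) (α : Fin l → ℕ) :
    Integrable (fun p : Matrix.unitaryGroup (Fin l) ℂ × (Fin l → Fin l → ℂ) => Phi m α p.1 p.2)
      (μ.prod volume) := by
  have h1 : Integrable (fun V : Fin l → Fin l → ℂ => ∏ r, (qf 1 (V r) ^ α r * gw (V r))) :=
    Integrable.fintype_prod_dep (μ := fun _ : Fin l => (volume : Measure (Fin l → ℂ)))
      (f := fun r v => qf 1 v ^ α r * gw v) (fun r => by
        have := diag_integrable (l := l) (fun _ => 1) (α r)
        rwa [Matrix.diagonal_one] at this)
  have h2 := h1.comp_snd μ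
  refine h2.mono (cont_Phi m α).aestronglyMeasurable (Filter.Eventually.of_forall fun p => ?_)
  simp only [Phi, norm_mul, norm_prod, norm_pow, norm_star, norm_det_unitary, one_pow, mul_one]
  refine Finset.prod_le_prod (fun r _ => by positivity) fun r _ => ?_
  gcongr
  refine (norm_qf_le p.1 _).trans ?_
  rw [qf_one, Complex.norm_real]
  exact le_abs_self _

lemma prod_hG {l : ℕ} (m : ℕ) (α : Fin l → ℕ) (U : Matrix.unitaryGroup (Fin l) ℂ) :
    (∏ r, hG (α r) (U : Matrix (Fin l) (Fin l) ℂ)) *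
      (star (Matrix.det (U : Matrix (Fin l) (Fin l) ℂ))) ^ m =
    (∏ r, (((α r).factorial : ℂ) * (Real.pi : ℂ) ^ l)⁻¹) * ∫ V, Phi m α U V := by
  unfold Phi hG
  rw [integral_mul_const, Finset.prod_mul_distrib, integral_fintype_prod_volume_eq_prod
    (f := fun r v => qf (U : Matrix (Fin l) (Fin l) ℂ) v ^ α r * gw v), mul_assoc]

lemma hG_integrable {l : ℕ} (μ : Measure (Matrix.unitaryGroup (Fin l) ℂ)) [IsProbabilityMeasure μ]
    (m : ℕ) (α : Fin l → ℕ) :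
    Integrable (fun U : Matrix.unitaryGroup (Fin l) ℂ =>
      (∏ r, hG (α r) (U : Matrix (Fin l) (Fin l) ℂ)) *
      (star (Matrix.det (U : Matrix (Fin l) (Fin l) ℂ))) ^ m) μ := by
  simp only [prod_hG]
  exact ((int_Phi μ m α).integral_prod_left).const_mul _

lemma hG_vanish {l : ℕ} (μ : Measure (Matrix.unitaryGroup (Fin l) ℂ)) [μ.IsHaarMeasure]
    [IsProbabilityMeasure μ]
    (m : ℕ) (α : Fin l → ℕ) (hα : ∃ r, α r ≠ m) :
    ∫ U : Matrix.unitaryGroup (Fin l) ℂ,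
      (∏ r, hG (α r) (U : Matrix (Fin l) (Fin l) ℂ)) *
      (star (Matrix.det (U : Matrix (Fin l) (Fin l) ℂ))) ^ m ∂μ = 0 := by
  simp only [prod_hG]
  rw [integral_const_mul, integral_integral_swap (int_Phi μ m α)]
  have : ∀ V : Fin l → Fin l → ℂ, ∫ U, Phi m α U V ∂μ = 0 := by
    intro V
    have h := inv_integral μ m α hα (Matrix.of fun r i => star (V r i)) (Matrix.of fun i r => V r i)
    have e : ∀ U : Matrix.unitaryGroup (Fin l) ℂ, Phi m α U V = (∏ r, gw (V r)) *
       ((∏ r, ((Matrix.of (fun r i => star (V r i)) * (U : Matrix (Fin l) (Fin l) ℂ) *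
         Matrix.of (fun i r => V r i)) r r) ^ α r) *
        (star (Matrix.det (U : Matrix (Fin l) (Fin l) ℂ))) ^ m) := by
      intro U
      have e2 : ∀ r, (Matrix.of (fun r i => star (V r i)) * (U : Matrix (Fin l) (Fin l) ℂ) *
         Matrix.of (fun i r => V r i)) r r = qf (U : Matrix (Fin l) (Fin l) ℂ) (V r) := by
        intro r
        rw [Matrix.mul_assoc]
        simp [qf, Matrix.mul_apply, dotProduct, Matrix.mulVec]
      simp only [e2, Phi, Finset.prod_mul_distrib]
      ring
    simp only [e]
    rw [integral_const_mul, h, mul_zero]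
  simp [this]
end UAvg

namespace UAvg
open Polynomial in
/-- linear functional on polynomials with moments `H` -/
noncomputable def Lam (H : ℕ → ℂ) : ℂ[X] →ₗ[ℂ] ℂ :=
  Polynomial.lsum (fun k => H k • (LinearMap.id : ℂ →ₗ[ℂ] ℂ))

lemma Lam_monomial (H : ℕ → ℂ) (k : ℕ) (a : ℂ) : Lam H (Polynomial.monomial k a) = a * H k := by
  rw [Lam, Polynomial.lsum_apply, Polynomial.sum_monomial_index] <;> simp [mul_comm]

lemma Lam_eq_sum (H : ℕ → ℂ) (p : Polynomial ℂ) (N : ℕ) (hN : p.natDegree < N) :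
    Lam H p = ∑ k ∈ Finset.range N, p.coeff k * H k := by
  conv_lhs => rw [p.as_sum_range' N hN]
  rw [map_sum]
  exact Finset.sum_congr rfl fun k _ => Lam_monomial _ _ _

lemma Lam_X_mul (H : ℕ → ℂ) (p : Polynomial ℂ) :
    Lam H (Polynomial.X * p) = Lam (fun k => H (k + 1)) p := by
  induction p using Polynomial.induction_on' with
  | add p q hp hq => rw [mul_add, map_add, map_add, hp, hq]
  | monomial n a => rw [Polynomial.X_mul_monomial, Lam_monomial, Lam_monomial]

lemma Lam_X_pow_mul (n : ℕ) (p : Polynomial ℂ) : ∀ (H : ℕ → ℂ),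
    Lam H (Polynomial.X ^ n * p) = Lam (fun k => H (k + n)) p := by
  induction n with
  | zero => intro H; simp
  | succ n ih => 
    intro H
    rw [pow_succ', mul_assoc, Lam_X_mul, ih]
    simp only [add_assoc]

lemma Lam_sub_mul (H : ℕ → ℂ) (x : ℂ) (p : Polynomial ℂ) :
    Lam H ((Polynomial.X - Polynomial.C x) * p) = Lam (fun k => H (k + 1) - x * H k) p := by
  rw [sub_mul, map_sub, Lam_X_mul, ← Polynomial.smul_eq_C_mul, map_smul]
  have h1 := Lam_eq_sum (fun k => H (k + 1)) p _ (Nat.lt_succ_self _)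
  have h2 := Lam_eq_sum H p _ (Nat.lt_succ_self _)
  have h3 := Lam_eq_sum (fun k => H (k + 1) - x * H k) p _ (Nat.lt_succ_self _)
  rw [h1, h2, h3, smul_eq_mul, Finset.mul_sum, ← Finset.sum_sub_distrib]
  exact Finset.sum_congr rfl fun k _ => by ring

lemma Lam_vanish {ι : Type*} (d : ι → ℂ) (S : Finset ι) (hS : S.Nonempty) :
    ∀ (H : ℕ → ℂ), PowerSeries.mk H * ∏ i ∈ S, (1 - PowerSeries.C (d i) * PowerSeries.X)
      = PowerSeries.X ^ (S.card - 1) → ∀ p : Polynomial ℂ,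
    Lam H ((∏ i ∈ S, (Polynomial.X - Polynomial.C (d i))) * p) = 0 := by
  have hD : ∀ (H : ℕ → ℂ) (x : ℂ), PowerSeries.mk H * (1 - PowerSeries.C x * PowerSeries.X)
      = PowerSeries.mk (fun k => H (k + 1) - x * H k) * PowerSeries.X + PowerSeries.C (H 0) := by
    intro H x
    ext n
    rw [mul_sub, mul_one, map_sub, ← mul_assoc]
    cases n with
    | zero => simp
    | succ n =>
      rw [PowerSeries.coeff_succ_mul_X, PowerSeries.coeff_mul_C, map_add,
        PowerSeries.coeff_succ_mul_X]
      simp [mul_comm]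
  induction hS using Finset.Nonempty.cons_induction with
  | singleton a =>
    intro H h p
    simp only [Finset.prod_singleton, Finset.card_singleton, Nat.sub_self, pow_zero] at h ⊢
    rw [Lam_sub_mul]
    have : (fun k => H (k + 1) - d a * H k) = fun _ => 0 := by
      funext k
      have h2 := congrArg (PowerSeries.coeff (k + 1)) h
      rw [hD, map_add, PowerSeries.coeff_succ_mul_X] at h2
      simpa [PowerSeries.coeff_C, PowerSeries.coeff_one] using h2
    rw [this, Lam_eq_sum _ _ _ (Nat.lt_succ_self _)]
    simp
  | cons a S ha hS ih =>
    intro H h p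
    rw [Finset.prod_cons] at h ⊢
    rw [Finset.card_cons, Nat.add_sub_cancel] at h
    rw [mul_assoc, Lam_sub_mul]
    apply ih
    have hc : 1 ≤ S.card := hS.card_pos
    have h0 : H 0 = 0 := by
      have h2 := congrArg (PowerSeries.constantCoeff) h
      have : S.card ≠ 0 := by omega
      simpa [this] using h2
    rw [← mul_assoc, hD, h0, map_zero, add_zero] at h
    have hX : (PowerSeries.X : PowerSeries ℂ) ≠ 0 := PowerSeries.X_ne_zero
    apply mul_right_cancel₀ hX
    rw [← pow_succ, Nat.sub_add_cancel hc, ← h]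
    ring

lemma sum_fin_poly {l : ℕ} (p : Polynomial ℂ) (hp : p.natDegree < l) :
    p = ∑ a : Fin l, Polynomial.C (p.coeff a) * Polynomial.X ^ (a : ℕ) := by
  conv_lhs => rw [p.as_sum_range' l hp]
  rw [Fin.sum_univ_eq_sum_range (fun a => Polynomial.C (p.coeff a) * Polynomial.X ^ a) l]
  exact Finset.sum_congr rfl fun k _ => (Polynomial.C_mul_X_pow_eq_monomial).symm

lemma det_Lam {l : ℕ} (hl : 1 ≤ l) (d : Fin l → ℂ) (H : ℕ → ℂ) (h0 : ∀ k, k < l - 1 → H k = 0)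
    (h1 : H (l - 1) = 1)
    (hg : PowerSeries.mk H * ∏ i, (1 - PowerSeries.C (d i) * PowerSeries.X)
      = PowerSeries.X ^ (l - 1)) (ψ : Polynomial ℂ) :
    Matrix.det (Matrix.of fun i j : Fin l =>
      Lam H (Polynomial.X ^ (i : ℕ) * (Polynomial.X ^ (j.rev : ℕ) * ψ))) = ∏ i, ψ.eval (d i) := by
  have hne : (Finset.univ : Finset (Fin l)).Nonempty := ⟨⟨0, hl⟩, Finset.mem_univ _⟩
  have hv : ∀ p : Polynomial ℂ, (∏ i, (Polynomial.X - Polynomial.C (d i))) ∣ p → Lam H p = 0 := by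
    rintro p ⟨q, rfl⟩
    exact Lam_vanish d Finset.univ hne H (by simpa using hg) q
  let N : Fin l → Polynomial ℂ := fun i => ∏ b ∈ Finset.Iio i, (Polynomial.X - Polynomial.C (d b))
  let R : Fin l → Polynomial ℂ := fun j => ∏ b ∈ Finset.Ioi j, (Polynomial.X - Polynomial.C (d b))
  have hNm : ∀ i, (N i).Monic := fun i => Polynomial.monic_prod_X_sub_C _ _
  have hRm : ∀ i, (R i).Monic := fun i => Polynomial.monic_prod_X_sub_C _ _
  have hNd : ∀ i, (N i).natDegree = i := fun i => by
    simp only [N]; rw [Polynomial.natDegree_finsetProd_X_sub_C_eq_card]; simp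
  have hRd : ∀ i, (R i).natDegree = (i.rev : ℕ) := fun i => by
    simp only [R]; rw [Polynomial.natDegree_finsetProd_X_sub_C_eq_card]; simp [Fin.val_rev]; omega
  have hlam1 : ∀ p : Polynomial ℂ, p.Monic → p.natDegree = l - 1 → Lam H p = 1 := by
    intro p hp hd
    rw [Lam_eq_sum H p l (by omega), Finset.sum_eq_single (l - 1)]
    · rw [h1, ← hd, mul_one]; exact hp
    · intro k hk hk2
      rw [h0 k (by have := Finset.mem_range.mp hk; omega), mul_zero]
    · intro h; exact absurd (Finset.mem_range.mpr (by omega)) h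
  -- triangular matrix
  have hT : Matrix.det (Matrix.of fun i j : Fin l => Lam H (N i * (R j * ψ))) = ∏ i, ψ.eval (d i) := by
    rw [Matrix.det_of_isUpperTriangular]
    · refine Finset.prod_congr rfl fun i _ => ?_
      rw [Matrix.of_apply]
      have hd : ∃ q, ψ = Polynomial.C (ψ.eval (d i)) + (Polynomial.X - Polynomial.C (d i)) * q := by
        obtain ⟨q, hq⟩ := Polynomial.X_sub_C_dvd_sub_C_eval (p := ψ) (a := d i)
        exact ⟨q, by rw [← hq]; ring⟩
      obtain ⟨q, hq⟩ := hd
      have hU : (∏ b, (Polynomial.X - Polynomial.C (d b))) = N i * R i * (Polynomial.X - Polynomial.C (d i)) := by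
        simp only [N, R]
        rw [← Finset.prod_union, mul_comm,
          ← Finset.prod_insert (f := fun b => Polynomial.X - Polynomial.C (d b)) (a := i)]
        · congr 1; ext b; simp; grind
        · simp
        · rw [Finset.disjoint_left]; intro b; simp; intro h; exact h.le
      have e : N i * (R i * ψ) = ψ.eval (d i) • (N i * R i) +
          (∏ b, (Polynomial.X - Polynomial.C (d b))) * q := by
        rw [hU, Polynomial.smul_eq_C_mul]
        conv_lhs => rw [hq]
        ring
      rw [e, map_add, map_smul, hv _ (dvd_mul_right _ _), hlam1]
      · simp
      · exact (hNm i).mul (hRm i)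
      · rw [(hNm i).natDegree_mul (hRm i), hNd, hRd, Fin.val_rev]; omega
    · intro i j hij
      rw [Matrix.of_apply]
      apply hv
      rw [← mul_assoc]
      apply Dvd.dvd.mul_right
      have : (Finset.univ : Finset (Fin l)) = Finset.Iio i ∪ Finset.Ici i := by
        ext b; simp; exact lt_or_ge _ _
      rw [this, Finset.prod_union]
      · apply mul_dvd_mul_left
        apply Finset.prod_dvd_prod_of_subset
        intro b; simp only [Finset.mem_Ici, Finset.mem_Ioi]; exact fun h => lt_of_lt_of_le hij h
      · rw [Finset.disjoint_left]; intro b; simp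
  have hP : Matrix.det (Matrix.of fun i j : Fin l => (N j).coeff i) = 1 :=
    Matrix.det_matrixOfPolynomials N hNd hNm
  have hQ : Matrix.det (Matrix.of fun b j : Fin l => (R j).coeff (b.rev : ℕ)) = 1 := by
    have := Matrix.det_matrixOfPolynomials (fun j => R j.rev) (fun i => by rw [hRd, Fin.rev_rev])
      (fun i => hRm _)
    rw [← Matrix.det_submatrix_equiv_self Fin.revPerm] at this
    rw [← this]
    congr 1
    ext b j
    simp
  have hfac : (Matrix.of fun i j : Fin l => Lam H (N i * (R j * ψ))) =
      (Matrix.of fun i j : Fin l => (N j).coeff i)ᵀ * (Matrix.of fun i j : Fin l =>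
      Lam H (Polynomial.X ^ (i : ℕ) * (Polynomial.X ^ (j.rev : ℕ) * ψ))) *
      (Matrix.of fun b j : Fin l => (R j).coeff (b.rev : ℕ)) := by
    ext i j
    simp only [Matrix.mul_apply, Matrix.of_apply, Matrix.transpose_apply]
    have eN := sum_fin_poly (N i) (by rw [hNd]; exact i.2)
    have eR := sum_fin_poly (R j) (by rw [hRd]; exact j.rev.2)
    rw [← Equiv.sum_comp Fin.revPerm] at eR
    simp only [Fin.revPerm_apply] at eR
    conv_lhs => rw [eN, eR]
    simp only [Finset.sum_mul, Finset.mul_sum, map_sum]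
    refine Finset.sum_congr rfl fun b _ => Finset.sum_congr rfl fun a _ => ?_
    have : Polynomial.C ((N i).coeff a) * Polynomial.X ^ (a : ℕ) *
        (Polynomial.C ((R j).coeff (b.rev : ℕ)) * Polynomial.X ^ (b.rev : ℕ) * ψ) =
        ((N i).coeff a * (R j).coeff (b.rev : ℕ)) •
          (Polynomial.X ^ (a : ℕ) * (Polynomial.X ^ (b.rev : ℕ) * ψ)) := by
      rw [Polynomial.smul_eq_C_mul, Polynomial.C_mul]; ring
    rw [this, map_smul, smul_eq_mul]
    ring
  rw [← hT, hfac, Matrix.det_mul, Matrix.det_mul, Matrix.det_transpose, hP, hQ]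
  ring
end UAvg

namespace UAvg

lemma aeval_conj {l : ℕ} (W : Matrix.unitaryGroup (Fin l) ℂ) (D : Matrix (Fin l) (Fin l) ℂ)
    (ψ : Polynomial ℂ) :
    Polynomial.aeval ((W : Matrix (Fin l) (Fin l) ℂ) * D * star (W : Matrix (Fin l) (Fin l) ℂ)) ψ =
      (W : Matrix (Fin l) (Fin l) ℂ) * Polynomial.aeval D ψ * star (W : Matrix (Fin l) (Fin l) ℂ) := by
  have hW := Matrix.mem_unitaryGroup_iff.mp W.2
  have hW' := Matrix.mem_unitaryGroup_iff'.mp W.2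
  induction ψ using Polynomial.induction_on' with
  | add p q hp hq => rw [map_add, map_add, hp, hq, mul_add, add_mul]
  | monomial n a =>
    have h : ((W : Matrix (Fin l) (Fin l) ℂ) * D * star (W : Matrix (Fin l) (Fin l) ℂ)) ^ n =
        (W : Matrix (Fin l) (Fin l) ℂ) * D ^ n * star (W : Matrix (Fin l) (Fin l) ℂ) := by
      induction n with
      | zero => simp [hW]
      | succ n ih =>
        rw [pow_succ, ih, pow_succ]
        calc _ = (W : Matrix (Fin l) (Fin l) ℂ) * D ^ n * (star (W : Matrix (Fin l) (Fin l) ℂ) *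
              (W : Matrix (Fin l) (Fin l) ℂ)) * D * star (W : Matrix (Fin l) (Fin l) ℂ) := by
                simp only [mul_assoc]
          _ = _ := by rw [hW', mul_one]; simp only [mul_assoc]
    rw [Polynomial.aeval_monomial, Polynomial.aeval_monomial, h, Algebra.algebraMap_eq_smul_one]
    simp

lemma eig {l : ℕ} (U : Matrix.unitaryGroup (Fin l) ℂ) : ∃ d : Fin l → ℂ,
    (∀ n, hG n (U : Matrix (Fin l) (Fin l) ℂ) = hG n (Matrix.diagonal d)) ∧
    (∀ ψ : Polynomial ℂ, Matrix.det (Polynomial.aeval (U : Matrix (Fin l) (Fin l) ℂ) ψ)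
      = ∏ i, ψ.eval (d i)) ∧
    Matrix.det (U : Matrix (Fin l) (Fin l) ℂ) = ∏ i, d i ∧ (∀ i, ‖d i‖ = 1) ∧
    Matrix.trace (U : Matrix (Fin l) (Fin l) ℂ) = ∑ i, d i := by
  obtain ⟨W, d, hU⟩ := spectral U
  have hW := Matrix.mem_unitaryGroup_iff.mp W.2
  have hW' := Matrix.mem_unitaryGroup_iff'.mp W.2
  have hdW : ∀ A : Matrix (Fin l) (Fin l) ℂ, Matrix.det ((W : Matrix (Fin l) (Fin l) ℂ) * A *
      star (W : Matrix (Fin l) (Fin l) ℂ)) = A.det := by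
    intro A
    rw [Matrix.det_mul, mul_comm, ← Matrix.det_mul, ← mul_assoc, hW', one_mul]
  have hdet : ∀ ψ : Polynomial ℂ, Matrix.det (Polynomial.aeval (U : Matrix (Fin l) (Fin l) ℂ) ψ)
      = ∏ i, ψ.eval (d i) := by
    intro ψ
    rw [hU, aeval_conj, hdW]
    have : Matrix.diagonal d = Matrix.diagonalAlgHom ℂ d := rfl
    rw [this, Polynomial.aeval_algHom_apply, Matrix.diagonalAlgHom_apply, Matrix.det_diagonal]
    refine Finset.prod_congr rfl fun i _ => ?_
    simp
  refine ⟨d, fun n => ?_, hdet, ?_, ?_, ?_⟩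
  · rw [hU, hG_conj]
  · rw [hU, hdW, Matrix.det_diagonal]
  · have h1 := Matrix.mem_unitaryGroup_iff.mp U.2
    have h2 : Matrix.diagonal d * star (Matrix.diagonal d) = 1 := by
      calc Matrix.diagonal d * star (Matrix.diagonal d) =
          (star (W : Matrix (Fin l) (Fin l) ℂ) * W) * Matrix.diagonal d *
          ((star (W : Matrix (Fin l) (Fin l) ℂ) * W) * star (Matrix.diagonal d) *
            (star (W : Matrix (Fin l) (Fin l) ℂ) * W)) := by
              rw [hW']; simp
        _ = star (W : Matrix (Fin l) (Fin l) ℂ) * (U * star (U : Matrix (Fin l) (Fin l) ℂ)) * W := by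
              rw [hU]; simp only [star_mul, star_star, mul_assoc]
        _ = 1 := by rw [h1, mul_one, hW']
    intro i
    have h3 := congrFun (congrFun h2 i) i
    simp only [Matrix.star_eq_conjTranspose, Matrix.diagonal_conjTranspose,
      Matrix.diagonal_mul_diagonal, Matrix.diagonal_apply_eq, Matrix.one_apply_eq, Pi.star_apply] at h3
    have h := congrArg norm h3
    rw [norm_mul, norm_star, norm_one] at h
    nlinarith [norm_nonneg (d i)]
  · rw [hU, Matrix.trace_mul_comm, ← mul_assoc, hW', one_mul, Matrix.trace_diagonal]

/-- shifted sequence -/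
noncomputable def Hs {l : ℕ} (U : Matrix (Fin l) (Fin l) ℂ) (k : ℕ) : ℂ :=
  if l - 1 ≤ k then hG (k - (l - 1)) U else 0

/-- coefficient arrays -/
noncomputable def bc {l : ℕ} (ψ : Polynomial ℂ) (N : ℕ) (i j : Fin l) (n : ℕ) : ℂ :=
  ∑ k ∈ Finset.range N, if k + i = n + j then ψ.coeff k else 0

lemma entry_eq {l : ℕ} (U : Matrix (Fin l) (Fin l) ℂ) (ψ : Polynomial ℂ) (N : ℕ)
    (hN : ψ.natDegree < N) (i j : Fin l) :
    Lam (Hs U) (Polynomial.X ^ (i : ℕ) * (Polynomial.X ^ (j.rev : ℕ) * ψ)) =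
      ∑ n ∈ Finset.range (N + l), bc ψ N i j n * hG n U := by
  rw [Lam_X_pow_mul, Lam_X_pow_mul, Lam_eq_sum _ _ _ hN]
  simp only [bc, Finset.sum_mul]
  rw [Finset.sum_comm]
  refine Finset.sum_congr rfl fun k hk => ?_
  have hk' := Finset.mem_range.mp hk
  have hj := j.2
  have hi := i.2
  have hr := Fin.val_rev j
  by_cases h : (j : ℕ) ≤ k + i
  · rw [Finset.sum_eq_single (k + i - j)]
    · rw [if_pos (by omega), Hs, if_pos (by omega)]
      congr 2
      omega
    · intro n _ hn
      rw [if_neg (by omega), zero_mul]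
    · intro h2; exact absurd (Finset.mem_range.mpr (by omega)) h2
  · rw [Hs, if_neg (by omega), mul_zero, Finset.sum_eq_zero]
    intro n _
    rw [if_neg (by omega), zero_mul]

lemma bc_eq {l : ℕ} (ψ : Polynomial ℂ) (N : ℕ) (hN : ψ.natDegree < N) (i j : Fin l) (m : ℕ)
    (hm : l ≤ m) : bc ψ N i j m = ψ.coeff (m + j - i) := by
  have hi := i.2
  unfold bc
  by_cases h : m + j - i < N
  · rw [Finset.sum_eq_single (m + j - i)]
    · rw [if_pos (by omega)]
    · intro k _ hk; rw [if_neg (by omega)]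
    · intro h2; exact absurd (Finset.mem_range.mpr h) h2
  · rw [Polynomial.coeff_eq_zero_of_natDegree_lt (by omega), Finset.sum_eq_zero]
    intro k hk
    have := Finset.mem_range.mp hk
    rw [if_neg (by omega)]

lemma det_aeval {l : ℕ} (hl : 1 ≤ l) (U : Matrix.unitaryGroup (Fin l) ℂ) (ψ : Polynomial ℂ) (N : ℕ)
    (hN : ψ.natDegree < N) :
    Matrix.det (Polynomial.aeval (U : Matrix (Fin l) (Fin l) ℂ) ψ) =
    Matrix.det (Matrix.of fun i j : Fin l =>
      ∑ n ∈ Finset.range (N + l), bc ψ N i j n * hG n (U : Matrix (Fin l) (Fin l) ℂ)) := by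
  obtain ⟨d, hh, hdet, -, -, -⟩ := eig U
  have hg := hG_gen d
  have h0 : hG 0 (Matrix.diagonal d) = 1 := by
    have := congrArg PowerSeries.constantCoeff hg
    rw [map_mul, map_prod] at this
    simpa using this
  have hX : PowerSeries.mk (Hs (U : Matrix (Fin l) (Fin l) ℂ)) =
      PowerSeries.X ^ (l - 1) * PowerSeries.mk (fun n => hG n (Matrix.diagonal d)) := by
    ext n
    rw [PowerSeries.coeff_X_pow_mul', PowerSeries.coeff_mk, Hs, PowerSeries.coeff_mk, hh]
  rw [hdet, ← det_Lam hl d (Hs (U : Matrix (Fin l) (Fin l) ℂ))]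
  · simp only [entry_eq _ ψ N hN]
  · intro k hk; rw [Hs, if_neg (by omega)]
  · rw [Hs, if_pos le_rfl, Nat.sub_self, hh, h0]
  · rw [hX, mul_assoc, hg, mul_one]

lemma thmT_aux {l : ℕ} (hl : 1 ≤ l) (μ : Measure (Matrix.unitaryGroup (Fin l) ℂ)) [μ.IsHaarMeasure]
    [IsProbabilityMeasure μ] (ψ : Polynomial ℂ) (m : ℕ) (hm : l ≤ m) :
    ∫ U : Matrix.unitaryGroup (Fin l) ℂ,
      Matrix.det (Polynomial.aeval (U : Matrix (Fin l) (Fin l) ℂ) ψ) *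
      (star (Matrix.det (U : Matrix (Fin l) (Fin l) ℂ))) ^ m ∂μ =
    Matrix.det (Matrix.of fun i j : Fin l => ψ.coeff (m + j - i)) *
     ∫ U : Matrix.unitaryGroup (Fin l) ℂ, (∏ _r : Fin l, hG m (U : Matrix (Fin l) (Fin l) ℂ)) *
      (star (Matrix.det (U : Matrix (Fin l) (Fin l) ℂ))) ^ m ∂μ := by
  obtain ⟨N, hN, hmN⟩ : ∃ N, ψ.natDegree < N ∧ m < N := ⟨ψ.natDegree + m + 1, by omega, by omega⟩
  have hpt : ∀ U : Matrix.unitaryGroup (Fin l) ℂ,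
      Matrix.det (Polynomial.aeval (U : Matrix (Fin l) (Fin l) ℂ) ψ) *
      (star (Matrix.det (U : Matrix (Fin l) (Fin l) ℂ))) ^ m =
      ∑ σ : Equiv.Perm (Fin l), ∑ α ∈ Fintype.piFinset (fun _ : Fin l => Finset.range (N + l)),
        (((Equiv.Perm.sign σ : ℤ) : ℂ) * ∏ i, bc ψ N (σ i) i (α i)) *
        ((∏ r, hG (α r) (U : Matrix (Fin l) (Fin l) ℂ)) *
          (star (Matrix.det (U : Matrix (Fin l) (Fin l) ℂ))) ^ m) := by
    intro U
    rw [det_aeval hl U ψ N hN, Matrix.det_apply', Finset.sum_mul]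
    refine Finset.sum_congr rfl fun σ _ => ?_
    simp only [Matrix.of_apply]
    rw [Finset.prod_univ_sum, Finset.mul_sum, Finset.sum_mul]
    refine Finset.sum_congr rfl fun α _ => ?_
    rw [Finset.prod_mul_distrib]
    ring
  simp only [hpt]
  rw [integral_finsetSum _ fun σ _ => integrable_finsetSum _ fun α _ => (hG_integrable μ m α).const_mul _]
  rw [Matrix.det_apply', Finset.sum_mul]
  refine Finset.sum_congr rfl fun σ _ => ?_
  rw [integral_finsetSum _ fun α _ => (hG_integrable μ m α).const_mul _]
  simp only [integral_const_mul]
  rw [Finset.sum_eq_single (fun _ => m)]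
  · simp only [Matrix.of_apply, bc_eq ψ N hN _ _ m hm]
  · intro α _ hα
    rw [hG_vanish μ m α (by by_contra h; push Not at h; exact hα (funext h)), mul_zero]
  · intro h
    refine absurd (Fintype.mem_piFinset.mpr fun i => Finset.mem_range.mpr ?_) h
    omega

lemma thmT {l : ℕ} (hl : 1 ≤ l) (μ : Measure (Matrix.unitaryGroup (Fin l) ℂ)) [μ.IsHaarMeasure]
    [IsProbabilityMeasure μ] (ψ : Polynomial ℂ) (m : ℕ) (hm : l ≤ m) :
    ∫ U : Matrix.unitaryGroup (Fin l) ℂ,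
      Matrix.det (Polynomial.aeval (U : Matrix (Fin l) (Fin l) ℂ) ψ) *
      (star (Matrix.det (U : Matrix (Fin l) (Fin l) ℂ))) ^ m ∂μ =
    Matrix.det (Matrix.of fun i j : Fin l => ψ.coeff (m + j - i)) := by
  have h1 := thmT_aux hl μ (Polynomial.X ^ m) m hm
  have e1 : ∀ U : Matrix.unitaryGroup (Fin l) ℂ,
      Matrix.det (Polynomial.aeval (U : Matrix (Fin l) (Fin l) ℂ) (Polynomial.X ^ m : Polynomial ℂ)) *
      (star (Matrix.det (U : Matrix (Fin l) (Fin l) ℂ))) ^ m = 1 := by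
    intro U
    have := congrArg Matrix.det (Matrix.mem_unitaryGroup_iff.mp U.2)
    rw [Matrix.det_mul, Matrix.star_eq_conjTranspose, Matrix.det_conjTranspose, Matrix.det_one] at this
    rw [map_pow, Polynomial.aeval_X, Matrix.det_pow, ← mul_pow, this, one_pow]
  have e2 : (Matrix.of fun i j : Fin l => (Polynomial.X ^ m : Polynomial ℂ).coeff (m + j - i)) = 1 := by
    ext i j
    rw [Matrix.of_apply, Polynomial.coeff_X_pow, Matrix.one_apply]
    have := i.2
    simp only [Fin.ext_iff]
    congr 1
    rw [eq_iff_iff]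
    omega
  simp only [e1, e2] at h1
  rw [thmT_aux hl μ ψ m hm]
  simp only [integral_const, probReal_univ, one_smul, Matrix.det_one, one_mul] at h1
  rw [← h1, mul_one]
end UAvg

namespace UAvg

lemma sign_rev (l : ℕ) : (Equiv.Perm.sign (Fin.revPerm : Equiv.Perm (Fin l)) : ℤˣ) = (-1) ^ (l * (l - 1) / 2) := by
  rw [Equiv.Perm.sign_eq_prod_prod_Iio]
  have : ∀ j : Fin l, (∏ i ∈ Finset.Iio j, if (Fin.revPerm i : Fin l) < Fin.revPerm j then (1 : ℤˣ) else -1)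
      = (-1) ^ (j : ℕ) := by
    intro j
    rw [Finset.prod_congr rfl (g := fun _ => (-1 : ℤˣ))]
    · simp
    · intro i hi
      rw [if_neg]
      have := Finset.mem_Iio.mp hi
      simp only [Fin.revPerm_apply, Fin.rev_lt_rev, not_lt]
      exact this.le
  simp only [this]
  rw [Finset.prod_pow_eq_pow_sum, Fin.sum_univ_eq_sum_range (fun i => i), Finset.sum_range_id]

lemma hankel (l : ℕ) (z : ℝ) :
    Matrix.det (Matrix.of fun j k : Fin l => besselI (((j : ℕ) : ℝ) - ((k : ℕ) : ℝ) + l) (2 * z))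
      = (-1 : ℝ) ^ (l * (l - 1) / 2) *
          Matrix.det (Matrix.of fun j k : Fin l => besselI (((j : ℕ) : ℝ) + ((k : ℕ) : ℝ) + 1) (2 * z)) := by
  have h := Matrix.det_permute' (Fin.revPerm : Equiv.Perm (Fin l))
    (Matrix.of fun j k : Fin l => besselI (((j : ℕ) : ℝ) + ((k : ℕ) : ℝ) + 1) (2 * z))
  rw [sign_rev] at h
  push_cast at h
  rw [← h]
  congr 1
  ext j k
  simp only [Matrix.submatrix_apply, id, Fin.revPerm_apply, Matrix.of_apply]
  congr 1
  have := k.2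
  rw [Fin.val_rev, Nat.cast_sub (by omega)]
  push_cast
  ring

/-- terms of the Bessel series -/
noncomputable def ut (z : ℝ) (n b : ℕ) : ℝ := z ^ (n + b) / (n + b).factorial * (z ^ b / b.factorial)

lemma ut_summable (z : ℝ) (n : ℕ) : Summable (ut z n) := by
  have h := (Real.summable_pow_div_factorial (z ^ 2)).mul_left (|z| ^ n)
  refine Summable.of_norm_bounded h fun b => ?_
  rw [ut, norm_mul, norm_div, norm_div, norm_pow, norm_pow, Real.norm_eq_abs]
  simp only [Real.norm_natCast]
  have h1 : (1 : ℝ) ≤ ((n + b).factorial : ℝ) := by exact_mod_cast Nat.one_le_iff_ne_zero.mpr (Nat.factorial_ne_zero _)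
  have e : |z| ^ n * ((z ^ 2) ^ b / (b.factorial : ℝ)) = |z| ^ (n + b) * (|z| ^ b / b.factorial) := by
    rw [← sq_abs z]; ring
  rw [e]
  gcongr
  exact div_le_self (by positivity) h1

lemma bessel_eq (z : ℝ) (n : ℕ) : besselI (n : ℝ) (2 * z) = ∑' b, ut z n b := by
  unfold besselI
  refine tsum_congr fun b => ?_
  have e1 : (n : ℝ) + 2 * (b : ℝ) = ((n + 2 * b : ℕ) : ℝ) := by push_cast; ring
  have e2 : (n : ℝ) + (b : ℝ) + 1 = ((n + b : ℕ) : ℝ) + 1 := by push_cast; ring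
  rw [e1, e2, Real.Gamma_nat_eq_factorial, Real.rpow_natCast, mul_div_cancel_left₀ z two_ne_zero, ut,
    div_mul_div_comm, ← pow_add, mul_comm (b.factorial : ℝ)]
  congr 2
  ring

/-- approximating Laurent polynomial times `X ^ K` -/
noncomputable def psiK (z : ℝ) (K : ℕ) : Polynomial ℂ :=
  (∑ a ∈ Finset.range (K + 1), Polynomial.C (((z ^ a / a.factorial : ℝ)) : ℂ) * Polynomial.X ^ a) *
  (∑ b ∈ Finset.range (K + 1), Polynomial.C (((z ^ b / b.factorial : ℝ)) : ℂ) * Polynomial.X ^ (K - b))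

lemma psiK_coeff (z : ℝ) (K n : ℕ) :
    (psiK z K).coeff (K + n) = ((∑ b ∈ Finset.range (K + 1 - n), ut z n b : ℝ) : ℂ) := by
  have h : psiK z K = ∑ b ∈ Finset.range (K + 1), ∑ a ∈ Finset.range (K + 1),
      Polynomial.C (((z ^ a / a.factorial * (z ^ b / b.factorial) : ℝ)) : ℂ) * Polynomial.X ^ (a + (K - b)) := by
    rw [psiK, Finset.mul_sum]
    refine Finset.sum_congr rfl fun b _ => ?_
    rw [Finset.sum_mul]
    refine Finset.sum_congr rfl fun a _ => ?_
    rw [Complex.ofReal_mul, Polynomial.C_mul, pow_add]; ring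
  rw [h]
  simp only [Polynomial.finsetSum_coeff, Polynomial.coeff_C_mul_X_pow]
  push_cast
  rw [← Finset.sum_subset (s₁ := Finset.range (K + 1 - n))]
  · refine Finset.sum_congr rfl fun b hb => ?_
    have hb' := Finset.mem_range.mp hb
    rw [Finset.sum_eq_single (n + b)]
    · rw [if_pos (by omega), ut]; push_cast; rfl
    · intro a _ ha
      rw [if_neg (by omega)]
    · intro h2; exact absurd (Finset.mem_range.mpr (by omega)) h2
  · intro b hb
    have := Finset.mem_range.mp hb
    exact Finset.mem_range.mpr (by omega)
  · intro b hb hb2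
    have h1 := Finset.mem_range.mp hb
    rw [Finset.mem_range] at hb2
    apply Finset.sum_eq_zero
    intro a ha
    have := Finset.mem_range.mp ha
    rw [if_neg (by omega)]

lemma psiK_lim (z : ℝ) (n : ℕ) :
    Filter.Tendsto (fun K => (psiK z K).coeff (K + n)) Filter.atTop
      (nhds ((besselI (n : ℝ) (2 * z) : ℝ) : ℂ)) := by
  simp only [psiK_coeff]
  refine (Complex.continuous_ofReal.tendsto _).comp ?_
  rw [bessel_eq]
  have h1 := (ut_summable z n).hasSum.tendsto_sum_nat
  exact h1.comp (Filter.tendsto_atTop_atTop.mpr fun b => ⟨b + n, fun a ha => by omega⟩)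

/-- partial exponential sums -/
noncomputable def sK (K : ℕ) (x : ℂ) : ℂ := ∑ a ∈ Finset.range (K + 1), x ^ a / a.factorial

lemma sK_lim (x : ℂ) : Filter.Tendsto (fun K => sK K x) Filter.atTop (nhds (Complex.exp x)) := by
  have h := NormedSpace.expSeries_div_hasSum_exp (𝔸 := ℂ) x
  rw [← Complex.exp_eq_exp_ℂ] at h
  exact h.tendsto_sum_nat.comp (Filter.tendsto_add_atTop_nat 1)

lemma sK_bound (K : ℕ) (x : ℂ) : ‖sK K x‖ ≤ Real.exp ‖x‖ := by
  refine (norm_sum_le _ _).trans ?_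
  refine le_trans (le_of_eq ?_) (Real.sum_le_exp_of_nonneg (norm_nonneg x) (K + 1))
  refine Finset.sum_congr rfl fun a _ => ?_
  rw [norm_div, norm_pow, Complex.norm_natCast]

lemma psiK_eval (z : ℝ) (K l : ℕ) (x : ℂ) (hx : ‖x‖ = 1) :
    (psiK z K).eval x * star x ^ (K + l) = sK K (z * x) * sK K (z * star x) * star x ^ l := by
  have hxx : x * star x = 1 := by
    have := Complex.mul_conj' x
    rw [hx] at this
    simpa using this
  rw [psiK, Polynomial.eval_mul, Polynomial.eval_finsetSum, Polynomial.eval_finsetSum]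
  simp only [Polynomial.eval_mul, Polynomial.eval_C, Polynomial.eval_pow, Polynomial.eval_X]
  have h1 : ∑ a ∈ Finset.range (K + 1), ((z ^ a / a.factorial : ℝ) : ℂ) * x ^ a = sK K (z * x) := by
    refine Finset.sum_congr rfl fun a _ => ?_
    push_cast; rw [mul_pow]; ring
  have h2 : (∑ b ∈ Finset.range (K + 1), ((z ^ b / b.factorial : ℝ) : ℂ) * x ^ (K - b)) * star x ^ K
      = sK K (z * star x) := by
    rw [Finset.sum_mul]
    refine Finset.sum_congr rfl fun b hb => ?_
    have hb' := Finset.mem_range.mp hb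
    have e : star x ^ K = star x ^ (K - b) * star x ^ b := by
      rw [← pow_add]; congr 1; omega
    rw [e, mul_assoc, ← mul_assoc (x ^ (K - b)), ← mul_pow, hxx, one_pow, one_mul]
    push_cast; rw [mul_pow]; ring
  rw [h1, pow_add, ← h2]
  ring

lemma main_conj {l : ℕ} (hl : 1 ≤ l) (μ : Measure (Matrix.unitaryGroup (Fin l) ℂ)) [μ.IsHaarMeasure]
    [IsProbabilityMeasure μ] (z : ℝ) :
    ∫ U : Matrix.unitaryGroup (Fin l) ℂ,
      (star (Matrix.det (U : Matrix (Fin l) (Fin l) ℂ))) ^ l *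
          Complex.exp ((z : ℂ) * Matrix.trace ((U : Matrix (Fin l) (Fin l) ℂ)
            + star (U : Matrix (Fin l) (Fin l) ℂ))) ∂μ =
    Matrix.det (Matrix.of fun i j : Fin l => ((besselI ((l + j - i : ℕ) : ℝ) (2 * z) : ℝ) : ℂ)) := by
  have hl1 : Filter.Tendsto (fun K => Matrix.det (Matrix.of fun i j : Fin l =>
      (psiK z K).coeff ((K + l) + j - i))) Filter.atTop
      (nhds (Matrix.det (Matrix.of fun i j : Fin l => ((besselI ((l + j - i : ℕ) : ℝ) (2 * z) : ℝ) : ℂ)))) := by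
    have hc : Continuous (fun A : Matrix (Fin l) (Fin l) ℂ => A.det) := continuous_id.matrix_det
    refine (hc.tendsto _).comp ?_
    refine tendsto_pi_nhds.mpr fun i => tendsto_pi_nhds.mpr fun j => ?_
    have := psiK_lim z (l + j - i)
    refine this.congr fun K => ?_
    have := i.2
    simp only [Matrix.of_apply]
    congr 1
    omega
  have hform : ∀ (K : ℕ) (U : Matrix.unitaryGroup (Fin l) ℂ) (d : Fin l → ℂ),
      (∀ ψ : Polynomial ℂ, Matrix.det (Polynomial.aeval (U : Matrix (Fin l) (Fin l) ℂ) ψ)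
      = ∏ i, ψ.eval (d i)) →
      Matrix.det (U : Matrix (Fin l) (Fin l) ℂ) = ∏ i, d i → (∀ i, ‖d i‖ = 1) →
      Matrix.det (Polynomial.aeval (U : Matrix (Fin l) (Fin l) ℂ) (psiK z K)) *
      (star (Matrix.det (U : Matrix (Fin l) (Fin l) ℂ))) ^ (K + l) =
      ∏ i, (sK K (z * d i) * sK K (z * star (d i)) * star (d i) ^ l) := by
    intro K U d h1 h2 h3
    rw [h1, h2, star_prod, ← Finset.prod_pow, ← Finset.prod_mul_distrib]
    exact Finset.prod_congr rfl fun i _ => psiK_eval z K l (d i) (h3 i)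
  have hl2 : Filter.Tendsto (fun K : ℕ => ∫ U : Matrix.unitaryGroup (Fin l) ℂ,
      Matrix.det (Polynomial.aeval (U : Matrix (Fin l) (Fin l) ℂ) (psiK z K)) *
      (star (Matrix.det (U : Matrix (Fin l) (Fin l) ℂ))) ^ (K + l) ∂μ) Filter.atTop
      (nhds (∫ U : Matrix.unitaryGroup (Fin l) ℂ,
      (star (Matrix.det (U : Matrix (Fin l) (Fin l) ℂ))) ^ l *
          Complex.exp ((z : ℂ) * Matrix.trace ((U : Matrix (Fin l) (Fin l) ℂ)
            + star (U : Matrix (Fin l) (Fin l) ℂ))) ∂μ)) := by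
    refine tendsto_integral_of_dominated_convergence (fun _ => ∏ _i : Fin l, (Real.exp |z| * Real.exp |z|))
      (fun K => ?_) (integrable_const _) (fun K => Filter.Eventually.of_forall fun U => ?_)
      (Filter.Eventually.of_forall fun U => ?_)
    · refine Continuous.aestronglyMeasurable ?_
      refine Continuous.mul ?_ ((cont_det.star).pow _)
      exact ((Polynomial.continuous_aeval (psiK z K)).comp continuous_subtype_val).matrix_det
    · obtain ⟨d, -, h1, h2, h3, -⟩ := eig U
      rw [hform K U d h1 h2 h3, norm_prod]
      refine Finset.prod_le_prod (fun i _ => norm_nonneg _) fun i _ => ?_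
      rw [norm_mul, norm_mul, norm_pow, norm_star, h3 i, one_pow, mul_one]
      have b1 := sK_bound K (z * d i)
      have b2 := sK_bound K (z * star (d i))
      rw [norm_mul, Complex.norm_real, Real.norm_eq_abs, h3, mul_one] at b1
      rw [norm_mul, Complex.norm_real, Real.norm_eq_abs, norm_star, h3, mul_one] at b2
      gcongr
    · obtain ⟨d, -, h1, h2, h3, h4⟩ := eig U
      simp only [hform _ U d h1 h2 h3]
      have e : (star (Matrix.det (U : Matrix (Fin l) (Fin l) ℂ))) ^ l *
          Complex.exp ((z : ℂ) * Matrix.trace ((U : Matrix (Fin l) (Fin l) ℂ)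
            + star (U : Matrix (Fin l) (Fin l) ℂ))) =
          ∏ i, (Complex.exp (z * d i) * Complex.exp (z * star (d i)) * star (d i) ^ l) := by
        rw [Finset.prod_mul_distrib, Finset.prod_mul_distrib, ← Complex.exp_sum, ← Complex.exp_sum,
          ← Complex.exp_add, Matrix.trace_add, Matrix.star_eq_conjTranspose,
          Matrix.trace_conjTranspose, h4, h2, star_prod, Finset.prod_pow, star_sum, mul_add,
          Finset.mul_sum, Finset.mul_sum, mul_comm]
      rw [e]
      exact tendsto_finsetProd _ fun i _ => ((sK_lim _).mul (sK_lim _)).mul tendsto_const_nhds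
  have e : ∀ K : ℕ, ∫ U : Matrix.unitaryGroup (Fin l) ℂ,
      Matrix.det (Polynomial.aeval (U : Matrix (Fin l) (Fin l) ℂ) (psiK z K)) *
      (star (Matrix.det (U : Matrix (Fin l) (Fin l) ℂ))) ^ (K + l) ∂μ =
      Matrix.det (Matrix.of fun i j : Fin l => (psiK z K).coeff ((K + l) + j - i)) :=
    fun K => thmT hl μ (psiK z K) (K + l) (by omega)
  simp only [e] at hl2
  exact tendsto_nhds_unique hl2 hl1

lemma main_first {l : ℕ} (hl : 1 ≤ l) (μ : Measure (Matrix.unitaryGroup (Fin l) ℂ)) [μ.IsHaarMeasure]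
    [IsProbabilityMeasure μ] (z : ℝ) :
    ∫ U : Matrix.unitaryGroup (Fin l) ℂ,
        (Matrix.det (U : Matrix (Fin l) (Fin l) ℂ)) ^ l *
          Complex.exp ((z : ℂ) * Matrix.trace ((U : Matrix (Fin l) (Fin l) ℂ)
            + star (U : Matrix (Fin l) (Fin l) ℂ))) ∂μ
      = ((Matrix.det (Matrix.of fun j k : Fin l =>
            besselI (((j : ℕ) : ℝ) - ((k : ℕ) : ℝ) + l) (2 * z)) : ℝ) : ℂ) := by
  have h := congrArg (starRingEnd ℂ) (main_conj hl μ z)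
  rw [← integral_conj] at h
  have e1 : ∀ U : Matrix.unitaryGroup (Fin l) ℂ, (starRingEnd ℂ)
      ((star (Matrix.det (U : Matrix (Fin l) (Fin l) ℂ))) ^ l *
          Complex.exp ((z : ℂ) * Matrix.trace ((U : Matrix (Fin l) (Fin l) ℂ)
            + star (U : Matrix (Fin l) (Fin l) ℂ)))) = (Matrix.det (U : Matrix (Fin l) (Fin l) ℂ)) ^ l *
          Complex.exp ((z : ℂ) * Matrix.trace ((U : Matrix (Fin l) (Fin l) ℂ)
            + star (U : Matrix (Fin l) (Fin l) ℂ))) := by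
    intro U
    rw [map_mul, map_pow, starRingEnd_apply, star_star, ← Complex.exp_conj, map_mul, Complex.conj_ofReal,
      starRingEnd_apply, ← Matrix.trace_conjTranspose, Matrix.star_eq_conjTranspose,
      Matrix.conjTranspose_add, Matrix.conjTranspose_conjTranspose, add_comm]
  simp only [e1] at h
  rw [h]
  have e2 : (Matrix.of fun i j : Fin l => ((besselI ((l + j - i : ℕ) : ℝ) (2 * z) : ℝ) : ℂ)) =
    ((Complex.ofRealHom).mapMatrix (Matrix.of fun j k : Fin l =>
            besselI (((j : ℕ) : ℝ) - ((k : ℕ) : ℝ) + l) (2 * z)))ᵀ := by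
    ext i j
    have := i.2
    rw [Matrix.of_apply, Matrix.transpose_apply, RingHom.mapMatrix_apply, Matrix.map_apply, Matrix.of_apply,
      Nat.cast_sub (by omega)]
    simp only [Complex.ofRealHom_eq_coe]
    congr 2
    push_cast
    ring
  rw [e2, Matrix.det_transpose, ← RingHom.map_det]
  exact Complex.conj_ofReal _
end UAvg

/-- The average of `(det U)^l exp(z Tr(U + U†))` over `U(l)` with normalized Haar measure
equals the Toeplitz determinant `det[I_{j-k+l}(2z)]_{j,k=0,…,l-1}`, which in turn equals
`(-1)^{l(l-1)/2}` times the Hankel determinant `det[I_{j+k+1}(2z)]_{j,k=0,…,l-1}`. -/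
theorem unitary_average_det_pow_eq_hankel_det (l : ℕ) (hl : 1 ≤ l)
    (μ : Measure (Matrix.unitaryGroup (Fin l) ℂ)) [μ.IsHaarMeasure] [IsProbabilityMeasure μ]
    (z : ℝ) :
    (∫ U : Matrix.unitaryGroup (Fin l) ℂ,
        (Matrix.det (U : Matrix (Fin l) (Fin l) ℂ)) ^ l *
          Complex.exp ((z : ℂ) * Matrix.trace ((U : Matrix (Fin l) (Fin l) ℂ)
            + star (U : Matrix (Fin l) (Fin l) ℂ))) ∂μ
      = ((Matrix.det (fun j k : Fin l =>
            besselI (((j : ℕ) : ℝ) - ((k : ℕ) : ℝ) + l) (2 * z)) : ℝ) : ℂ))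
    ∧ (Matrix.det (fun j k : Fin l => besselI (((j : ℕ) : ℝ) - ((k : ℕ) : ℝ) + l) (2 * z))
      = (-1 : ℝ) ^ (l * (l - 1) / 2) *
          Matrix.det (fun j k : Fin l => besselI (((j : ℕ) : ℝ) + ((k : ℕ) : ℝ) + 1) (2 * z))) := by
  exact ⟨UAvg.main_first hl μ z, UAvg.hankel l z⟩
end

section
/- Let n ≥ 1 be an integer, let a > −1, b > 0, β ≥ 0 be real, and for p = 0,…,n define Ĥ_p(x) := (1/C(n,p)) ∫_{[0,1]^n} ∏_{r=1}^n t_r^a (1−t_r)^{b−1} · e^{−x Σ_{r=1}^n t_r} · ∏_{1 ≤ j < k ≤ n} |t_k − t_j|^β · e_p(1−t_1,…,1−t_n) dt_1⋯dt_n, where C(n,p) is the binomial coefficient and e_p is the p-th elementary symmetric polynomial. Then for every x ∈ ℝ and every p = 0,…,n, (n−p) x Ĥ_{p+1}(x) = ((n−p)x + B̃_p) Ĥ_p(x) + x (d/dx)Ĥ_p(x) − D̃_p Ĥ_{p−1}(x), where B̃_p = p(a + b + 1 + (β/2)(2n − p − 1)) and D̃_p = p((β/2)(n − p) + b), with the conventions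 that the term (n−p)xĤ_{p+1} is absent when p = n (its coefficient vanishes) and the term D̃_pĤ_{p−1} is absent when p = 0 (since D̃_0 = 0). -/
open Real MeasureTheory

/-- The Selberg-type correlation integral
`Ĥ_p(x) = (1/C(n,p)) ∫_{[0,1]^n} ∏ t_r^a (1−t_r)^{b−1} e^{−xΣt_r} ∏_{j<k}|t_k−t_j|^β
e_p(1−t_1,…,1−t_n) dt`. -/
noncomputable def selbergH (n : ℕ) (a b β : ℝ) (p : ℕ) (x : ℝ) : ℝ :=
  (1 / (n.choose p : ℝ)) *
    ∫ t : Fin n → ℝ in Set.univ.pi (fun _ => Set.Icc (0:ℝ) 1),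
      (∏ r, (t r) ^ a * (1 - t r) ^ (b - 1)) * Real.exp (-x * ∑ r, t r) *
      (∏ j, ∏ k ∈ Finset.Ioi j, |t k - t j| ^ β) *
      (∑ s ∈ Finset.univ.powersetCard p, ∏ i ∈ s, (1 - t i))

/-- `B̃_p = p(a + b + 1 + (β/2)(2n − p − 1))`. -/
noncomputable def Btil (n : ℕ) (a b β : ℝ) (p : ℕ) : ℝ :=
  p * (a + b + 1 + (β / 2) * (2 * n - p - 1))

/-- `D̃_p = p((β/2)(n − p) + b)`. -/
noncomputable def Dtil (n : ℕ) (b β : ℝ) (p : ℕ) : ℝ :=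
  p * ((β / 2) * ((n : ℝ) - p) + b)

/-- elementary symmetric sum over a finset -/
noncomputable def esS {ι : Type} (y : ι → ℝ) (S : Finset ι) (q : ℕ) : ℝ :=
  ∑ s ∈ S.powersetCard q, ∏ i ∈ s, y i

lemma esS_zero {ι : Type} (y : ι → ℝ) (S : Finset ι) : esS y S 0 = 1 := by
  simp [esS]

lemma esS_one {ι : Type} (y : ι → ℝ) (S : Finset ι) : esS y S 1 = ∑ i ∈ S, y i := by
  simp [esS, Finset.powersetCard_one]

lemma esS_succ {ι : Type} [DecidableEq ι] (y : ι → ℝ) (S : Finset ι) (i : ι) (hi : i ∈ S)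
    (q : ℕ) : esS y S (q + 1) = esS y (S.erase i) (q + 1) + y i * esS y (S.erase i) q := by
  have hn : i ∉ S.erase i := Finset.notMem_erase i S
  have h := Finset.powersetCard_succ_insert hn q
  rw [Finset.insert_erase hi] at h
  have hmem : ∀ n, ∀ s ∈ (S.erase i).powersetCard n, i ∉ s := by
    intro n s hs hi'
    exact hn ((Finset.mem_powersetCard.1 hs).1 hi')
  unfold esS
  rw [h, Finset.sum_union, Finset.sum_image, Finset.mul_sum]
  · congr 1
    refine Finset.sum_congr rfl fun s hs => ?_
    rw [Finset.prod_insert (hmem _ s hs)]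
  · intro s hs t ht hst
    have := congrArg (fun u => Finset.erase u i) hst
    simpa [Finset.erase_insert (hmem _ s hs), Finset.erase_insert (hmem _ t ht)] using this
  · rw [Finset.disjoint_left]
    intro s hs hs'
    obtain ⟨t, ht, rfl⟩ := Finset.mem_image.1 hs'
    exact hmem _ _ hs (Finset.mem_insert_self i t)

lemma esS_I1 {ι : Type} [DecidableEq ι] (y : ι → ℝ) (S : Finset ι) (q : ℕ) :
    ∑ i ∈ S, y i * esS y (S.erase i) q = (q + 1) * esS y S (q + 1) := by
  have h1 : ∀ i ∈ S, y i * esS y (S.erase i) q =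
      ∑ s ∈ S.powersetCard (q + 1), if i ∈ s then ∏ j ∈ s, y j else 0 := by
    intro i hi
    have h := esS_succ y S i hi q
    have h2 : esS y (S.erase i) (q + 1) =
      ∑ s ∈ S.powersetCard (q + 1), if i ∈ s then 0 else ∏ j ∈ s, y j := by
      unfold esS
      rw [Finset.sum_ite, Finset.sum_const_zero, zero_add]
      refine Finset.sum_congr ?_ fun _ _ => rfl
      ext s
      simp only [Finset.mem_powersetCard, Finset.mem_filter, Finset.subset_erase]
      tauto
    rw [h2] at h
    rw [← add_right_inj, ← h, ← Finset.sum_add_distrib]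
    unfold esS
    refine Finset.sum_congr rfl fun s _ => ?_
    split_ifs <;> simp
  rw [Finset.sum_congr rfl h1, Finset.sum_comm]
  unfold esS
  rw [Finset.mul_sum]
  refine Finset.sum_congr rfl fun s hs => ?_
  obtain ⟨hs1, hs2⟩ := Finset.mem_powersetCard.1 hs
  rw [← Finset.sum_filter, Finset.filter_mem_eq_inter, Finset.inter_eq_right.2 hs1,
    Finset.sum_const, hs2]
  simp

lemma esS_I2 {ι : Type} [DecidableEq ι] (y : ι → ℝ) (S : Finset ι) (q : ℕ) :
    ∑ i ∈ S, esS y (S.erase i) q = ((S.card : ℝ) - q) * esS y S q := by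
  cases q with
  | zero => simp [esS_zero]
  | succ q =>
    have h : ∀ i ∈ S, esS y (S.erase i) (q + 1) =
        esS y S (q + 1) - y i * esS y (S.erase i) q := fun i hi => by
      rw [esS_succ y S i hi q]; ring
    rw [Finset.sum_congr rfl h, Finset.sum_sub_distrib, esS_I1]
    simp; ring

lemma esS_I3 {ι : Type} [DecidableEq ι] (y : ι → ℝ) (S : Finset ι) (q : ℕ) :
    ∑ i ∈ S, y i * (y i * esS y (S.erase i) q) =
      (∑ i ∈ S, y i) * esS y S (q + 1) - (q + 2) * esS y S (q + 2) := by
  have h : ∀ i ∈ S, y i * (y i * esS y (S.erase i) q) =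
      y i * esS y S (q + 1) - y i * esS y (S.erase i) (q + 1) := fun i hi => by
    rw [esS_succ y S i hi q]; ring
  rw [Finset.sum_congr rfl h, Finset.sum_sub_distrib, esS_I1, Finset.sum_mul]
  push_cast; ring

/-- pair coefficient -/
noncomputable def Qp {n : ℕ} (y : Fin n → ℝ) (q : ℕ) (j k : Fin n) : ℝ :=
  y j * esS y (Finset.univ.erase j) q - esS y ((Finset.univ.erase j).erase k) q
    + y k * esS y ((Finset.univ.erase j).erase k) q

lemma esS_pair {n : ℕ} (y : Fin n → ℝ) (q : ℕ) (j k : Fin n) (h : j ≠ k) :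
    y j * (esS y (Finset.univ.erase j) q - esS y ((Finset.univ.erase j).erase k) q) =
    y k * (esS y (Finset.univ.erase k) q - esS y ((Finset.univ.erase j).erase k) q) := by
  cases q with
  | zero => simp [esS_zero]
  | succ q =>
    rw [esS_succ y (Finset.univ.erase j) k (by simp [h.symm]) q,
      esS_succ y (Finset.univ.erase k) j (by simp [h]) q, Finset.erase_right_comm (a := k)]
    ring

lemma Qp_symm {n : ℕ} (y : Fin n → ℝ) (q : ℕ) (j k : Fin n) (h : j ≠ k) :
    Qp y q j k = Qp y q k j := by
  have := esS_pair y q j k h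
  unfold Qp
  rw [Finset.erase_right_comm (a := k)]
  linarith

lemma Qp_diff {n : ℕ} (y : Fin n → ℝ) (q : ℕ) (j k : Fin n) (h : j ≠ k) :
    (1 - y k) * y k * esS y (Finset.univ.erase k) q
      - (1 - y j) * y j * esS y (Finset.univ.erase j) q = (y j - y k) * Qp y q j k := by
  have := esS_pair y q j k h
  unfold Qp
  linear_combination (y k - 1) * this

lemma sum_pairs_symm {n : ℕ} (Q : Fin n → Fin n → ℝ) (h : ∀ j k, j ≠ k → Q j k = Q k j) :
    2 * ∑ j, ∑ k ∈ Finset.Ioi j, Q j k = ∑ j, ∑ k ∈ Finset.univ.erase j, Q j k := by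
  have h1 : ∀ j : Fin n, ∑ k ∈ Finset.univ.erase j, Q j k
      = ∑ k ∈ Finset.Ioi j, Q j k + ∑ k ∈ Finset.Iio j, Q j k := by
    intro j
    rw [← Finset.sum_union]
    · refine Finset.sum_congr ?_ fun _ _ => rfl
      ext k; simp; omega
    · rw [Finset.disjoint_left]; intro k; simp; omega
  rw [Finset.sum_congr rfl fun j _ => h1 j, Finset.sum_add_distrib, two_mul]
  congr 1
  rw [Finset.sum_comm' (t' := Finset.univ) (s' := fun k => Finset.Iio k) (by simp)]
  refine Finset.sum_congr rfl fun k _ => Finset.sum_congr rfl fun j hj => h _ _ ?_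
  exact (Finset.mem_Iio.1 hj).ne

lemma Qp_sum {n : ℕ} (y : Fin n → ℝ) (q : ℕ) :
    2 * ∑ j, ∑ k ∈ Finset.Ioi j, Qp y q j k =
      (q + 1) * (2 * n - q - 2) * esS y Finset.univ (q + 1)
        - ((n : ℝ) - 1 - q) * (n - q) * esS y Finset.univ q := by
  rw [sum_pairs_symm _ (Qp_symm y q)]
  have h1 : ∀ j : Fin n, ∑ k ∈ Finset.univ.erase j, Qp y q j k =
      ((n : ℝ) - 1) * (y j * esS y (Finset.univ.erase j) q)
      - ((n : ℝ) - 1 - q) * esS y (Finset.univ.erase j) q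
      + (q + 1) * esS y (Finset.univ.erase j) (q + 1) := by
    intro j
    have hc : ((Finset.univ.erase j).card : ℝ) = n - 1 := by
      have := j.pos
      rw [Finset.card_erase_of_mem (Finset.mem_univ j), Finset.card_univ, Fintype.card_fin,
        Nat.cast_sub (by omega)]
      simp
    unfold Qp
    rw [Finset.sum_add_distrib, Finset.sum_sub_distrib, esS_I1, esS_I2, Finset.sum_const,
      nsmul_eq_mul, hc]
  rw [Finset.sum_congr rfl fun j _ => h1 j, Finset.sum_add_distrib, Finset.sum_sub_distrib,
    ← Finset.mul_sum, ← Finset.mul_sum, ← Finset.mul_sum, esS_I1, esS_I2, esS_I2]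
  simp; ring
lemma beta_int (a b : ℝ) (ha : -1 < a) (hb : 0 < b) :
    Integrable (fun s : ℝ => s ^ a * (1 - s) ^ (b - 1)) (volume.restrict (Set.Icc 0 1)) := by
  have h := Complex.betaIntegral_convergent (u := (a + 1 : ℝ)) (v := (b : ℝ))
    (by rw [Complex.ofReal_re]; linarith) (by simpa)
  rw [intervalIntegrable_iff_integrableOn_Ioc_of_le zero_le_one,
    ← integrableOn_Icc_iff_integrableOn_Ioc] at h
  refine (Integrable.norm h).congr ?_
  rw [← Measure.restrict_congr_set Ioo_ae_eq_Icc]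
  filter_upwards [ae_restrict_mem measurableSet_Ioo] with s hs
  have h1 : (0 : ℝ) < 1 - s := by linarith [hs.2]
  have h2 : (1 - (s : ℂ)) = ((1 - s : ℝ) : ℂ) := by push_cast; rfl
  rw [norm_mul, h2, Complex.norm_cpow_eq_rpow_re_of_pos h1,
    Complex.norm_cpow_eq_rpow_re_of_pos hs.1]
  simp

lemma oneD (a b : ℝ) (ha : -1 < a) (hb : 0 < b) (g g' : ℝ → ℝ)
    (hg : ∀ s, HasDerivAt g (g' s) s) (hg' : Continuous g') :
    ∫ s in Set.Icc (0:ℝ) 1, (s ^ a * (1 - s) ^ (b - 1)) *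
      (((a + 1) * (1 - s) - b * s) * g s + s * (1 - s) * g' s) = 0 := by
  have hgc : Continuous g := continuous_iff_continuousAt.2 fun s => (hg s).continuousAt
  rw [integral_Icc_eq_integral_Ioc, ← intervalIntegral.integral_of_le zero_le_one]
  rw [intervalIntegral.integral_eq_sub_of_hasDerivAt_of_le
    (f := fun s => s ^ (a + 1) * (1 - s) ^ b * g s) zero_le_one]
  · have : a + 1 ≠ 0 := by linarith
    simp [Real.zero_rpow this, Real.zero_rpow hb.ne']
  · refine ContinuousOn.mul (Continuous.continuousOn ?_) hgc.continuousOn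
    exact (continuous_id.rpow_const fun _ => Or.inr (by linarith)).mul
      ((continuous_const.sub continuous_id).rpow_const fun _ => Or.inr hb.le)
  · intro s hs
    have h1 : (0 : ℝ) < 1 - s := by linarith [hs.2]
    have h0 := hs.1
    have d1 : HasDerivAt (fun s : ℝ => s ^ (a + 1)) _ s :=
      Real.hasDerivAt_rpow_const (Or.inl h0.ne')
    have d2 : HasDerivAt (fun s : ℝ => (1 - s) ^ b) _ s :=
      ((hasDerivAt_id s).const_sub 1).rpow_const (Or.inl h1.ne')
    refine ((d1.mul d2).mul (hg s)).congr_deriv ?_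
    have e1 : s ^ (a + 1) = s ^ a * s := by rw [Real.rpow_add_one h0.ne']
    have e2 : (1 - s) ^ b = (1 - s) ^ (b - 1) * (1 - s) := by
      rw [← Real.rpow_add_one h1.ne']; simp
    simp only [id, add_sub_cancel_right]
    simp only [Pi.mul_apply]
    rw [e1, e2]; ring
  · rw [intervalIntegrable_iff_integrableOn_Icc_of_le zero_le_one]
    refine IntegrableOn.mul_continuousOn (beta_int a b ha hb) ?_ isCompact_Icc
    fun_prop

/-- cube -/
def cube (n : ℕ) : Set (Fin n → ℝ) := Set.univ.pi (fun _ => Set.Icc (0:ℝ) 1)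

/-- weight -/
noncomputable def wt {n : ℕ} (a b : ℝ) (t : Fin n → ℝ) : ℝ :=
  ∏ r, (t r) ^ a * (1 - t r) ^ (b - 1)

lemma cube_compact (n : ℕ) : IsCompact (cube n) := isCompact_univ_pi fun _ => isCompact_Icc

lemma cube_meas (n : ℕ) : MeasurableSet (cube n) := (cube_compact n).measurableSet

lemma cube_restrict (n : ℕ) : (volume.restrict (cube n) : Measure (Fin n → ℝ)) =
    Measure.pi fun _ => (volume.restrict (Set.Icc (0:ℝ) 1)) := by
  unfold cube
  rw [volume_pi, Measure.restrict_pi_pi]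

lemma wt_int {n : ℕ} (a b : ℝ) (ha : -1 < a) (hb : 0 < b) :
    Integrable (wt a b) (volume.restrict (cube n)) := by
  rw [cube_restrict]
  exact Integrable.fintype_prod fun _ => beta_int a b ha hb

lemma wt_mul_int {n : ℕ} (a b : ℝ) (ha : -1 < a) (hb : 0 < b) (h : (Fin n → ℝ) → ℝ)
    (hc : Continuous h) : Integrable (fun t => wt a b t * h t) (volume.restrict (cube n)) :=
  IntegrableOn.mul_continuousOn (wt_int a b ha hb) hc.continuousOn (cube_compact n)

lemma nD {n : ℕ} (a b : ℝ) (ha : -1 < a) (hb : 0 < b) (i : Fin n) (G G' : (Fin n → ℝ) → ℝ)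
    (hG : Continuous G) (hG' : Continuous G')
    (hd : ∀ t, HasDerivAt (fun s => G (Function.update t i s)) (G' t) (t i)) :
    ∫ t in cube n, wt a b t *
      (((a + 1) * (1 - t i) - b * t i) * G t + t i * (1 - t i) * G' t) = 0 := by
  obtain ⟨m, rfl⟩ : ∃ m, n = m + 1 := ⟨n - 1, by have := i.pos; omega⟩
  have hint := wt_mul_int a b ha hb
    (fun t => ((a + 1) * (1 - t i) - b * t i) * G t + t i * (1 - t i) * G' t) (by fun_prop)
  rw [cube_restrict] at hint ⊢
  have mp := measurePreserving_piFinSuccAbove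
    (fun _ : Fin (m + 1) => (volume.restrict (Set.Icc (0:ℝ) 1))) i
  have mps := mp.symm
  rw [← mps.integral_comp (MeasurableEquiv.measurableEmbedding _)]
  rw [← mps.integrable_comp_emb (MeasurableEquiv.measurableEmbedding _)] at hint
  refine (integral_prod_symm _ hint).trans ?_
  refine integral_eq_zero_of_ae (Filter.Eventually.of_forall fun y => ?_)
  have he : ∀ s, (MeasurableEquiv.piFinSuccAbove (fun _ : Fin (m + 1) => ℝ) i).symm (s, y)
    = i.insertNth s y := fun s => rfl
  simp only [Function.comp, he, Fin.insertNth_apply_same, Pi.zero_apply]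
  have hw : ∀ s, wt a b (i.insertNth s y) = wt a b y * (s ^ a * (1 - s) ^ (b - 1)) := by
    intro s
    unfold wt
    rw [Fin.prod_univ_succAbove _ i]
    simp only [Fin.insertNth_apply_same, Fin.insertNth_apply_succAbove]
    ring
  simp only [hw, mul_assoc (wt a b y)]
  rw [integral_const_mul]
  convert mul_zero (wt a b y) using 2
  have hi : Continuous fun s : ℝ => (i.insertNth s y : Fin (m + 1) → ℝ) := by fun_prop
  refine oneD a b ha hb (fun s => G (i.insertNth s y)) (fun s => G' (i.insertNth s y)) ?_
    (hG'.comp hi)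
  intro s
  have := hd (i.insertNth s y)
  simpa using this
/-- regularized Vandermonde factor -/
noncomputable def Vr {n : ℕ} (β ε : ℝ) (t : Fin n → ℝ) : ℝ :=
  ∏ j, ∏ k ∈ Finset.Ioi j, ((t k - t j) ^ 2 + ε) ^ (β / 2)

lemma Vr_cont {n : ℕ} (β : ℝ) (hβ : 0 ≤ β) :
    Continuous fun z : ℝ × (Fin n → ℝ) => Vr β z.1 z.2 := by
  unfold Vr
  refine continuous_finsetProd _ fun j _ => continuous_finsetProd _ fun k _ => ?_
  refine Continuous.rpow_const (by fun_prop) fun _ => Or.inr (by linarith)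

lemma Vr_cont_right {n : ℕ} (β ε : ℝ) (hβ : 0 ≤ β) :
    Continuous fun t : (Fin n → ℝ) => Vr β ε t := by
  unfold Vr
  refine continuous_finsetProd _ fun j _ => continuous_finsetProd _ fun k _ => ?_
  refine Continuous.rpow_const (by fun_prop) fun _ => Or.inr (by linarith)

lemma Vr_cont_left {n : ℕ} (β : ℝ) (t : Fin n → ℝ) (hβ : 0 ≤ β) :
    Continuous fun ε : ℝ => Vr β ε t := by
  unfold Vr
  refine continuous_finsetProd _ fun j _ => continuous_finsetProd _ fun k _ => ?_
  refine Continuous.rpow_const (by fun_prop) fun _ => Or.inr (by linarith)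

lemma Vr_zero {n : ℕ} (β : ℝ) (t : Fin n → ℝ) :
    Vr β 0 t = ∏ j, ∏ k ∈ Finset.Ioi j, |t k - t j| ^ β := by
  unfold Vr
  refine Finset.prod_congr rfl fun j _ => Finset.prod_congr rfl fun k _ => ?_
  rw [add_zero, ← sq_abs, ← Real.rpow_natCast, ← Real.rpow_mul (abs_nonneg _)]
  congr 1; push_cast; ring

lemma Vr_eq_exp {n : ℕ} (β ε : ℝ) (hε : 0 < ε) (t : Fin n → ℝ) :
    Vr β ε t = Real.exp (∑ j, ∑ k ∈ Finset.Ioi j, Real.log ((t k - t j) ^ 2 + ε) * (β / 2)) := by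
  unfold Vr
  simp only [Real.exp_sum]
  refine Finset.prod_congr rfl fun j _ => Finset.prod_congr rfl fun k _ => ?_
  rw [Real.rpow_def_of_pos (by positivity)]

/-- complemented variables -/
def cv {n : ℕ} (t : Fin n → ℝ) : Fin n → ℝ := fun i => 1 - t i

lemma cv_cont {n : ℕ} : Continuous (cv : (Fin n → ℝ) → _) := by unfold cv; fun_prop

lemma esS_cont {n : ℕ} (S : Finset (Fin n)) (q : ℕ) :
    Continuous fun t : Fin n → ℝ => esS (cv t) S q := by
  unfold esS cv; fun_prop

lemma Qp_cont {n : ℕ} (q : ℕ) (j k : Fin n) :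
    Continuous fun t : Fin n → ℝ => Qp (cv t) q j k := by
  have h1 := esS_cont (Finset.univ.erase j) q
  have h2 := esS_cont ((Finset.univ.erase j).erase k) q
  have h3 : Continuous (cv : (Fin n → ℝ) → _) := cv_cont
  unfold Qp
  fun_prop

lemma esS_update {n : ℕ} (t : Fin n → ℝ) (i : Fin n) (s : ℝ) (q : ℕ) :
    esS (cv (Function.update t i s)) (Finset.univ.erase i) q = esS (cv t) (Finset.univ.erase i) q := by
  unfold esS cv
  refine Finset.sum_congr rfl fun S hS => Finset.prod_congr rfl fun j hj => ?_
  have : j ≠ i := by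
    rintro rfl
    exact Finset.notMem_erase j _ ((Finset.mem_powersetCard.1 hS).1 hj)
  rw [Function.update_of_ne this]

/-- log-derivative pair coefficient -/
noncomputable def cc {n : ℕ} (β ε : ℝ) (t : Fin n → ℝ) (j k : Fin n) : ℝ :=
  β * (t k - t j) / ((t k - t j) ^ 2 + ε)

/-- log-derivative -/
noncomputable def LD {n : ℕ} (β ε x : ℝ) (i : Fin n) (t : Fin n → ℝ) : ℝ :=
  -x + ∑ j, ∑ k ∈ Finset.Ioi j, cc β ε t j k *
    ((Pi.single i (1:ℝ) : Fin n → ℝ) k - (Pi.single i (1:ℝ) : Fin n → ℝ) j)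

lemma cc_cont {n : ℕ} (β ε : ℝ) (hε : 0 < ε) (j k : Fin n) :
    Continuous fun t : Fin n → ℝ => cc β ε t j k := by
  unfold cc
  refine Continuous.div (by fun_prop) (by fun_prop) fun t => by positivity

lemma LD_cont {n : ℕ} (β ε x : ℝ) (hε : 0 < ε) (i : Fin n) : Continuous (LD β ε x i) := by
  unfold LD
  have := fun j k => cc_cont (n := n) β ε hε j k
  fun_prop

/-- the function to which integration by parts is applied -/
noncomputable def GG {n : ℕ} (β ε x : ℝ) (q : ℕ) (i : Fin n) (t : Fin n → ℝ) : ℝ :=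
  Real.exp (-x * ∑ r, t r) * Vr β ε t * esS (cv t) (Finset.univ.erase i) q

lemma GG_cont {n : ℕ} (β ε x : ℝ) (hβ : 0 ≤ β) (q : ℕ) (i : Fin n) : Continuous (GG β ε x q i) := by
  have h1 := esS_cont (Finset.univ.erase i) q
  have h2 := Vr_cont_right (n := n) β ε hβ
  unfold GG
  fun_prop

lemma GG_deriv {n : ℕ} (β ε x : ℝ) (hε : 0 < ε) (q : ℕ) (i : Fin n) (t : Fin n → ℝ) :
    HasDerivAt (fun s => GG β ε x q i (Function.update t i s)) (LD β ε x i t * GG β ε x q i t)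
      (t i) := by
  have hu : ∀ k, HasDerivAt (fun s => Function.update t i s k)
      ((Pi.single i (1:ℝ) : Fin n → ℝ) k) (t i) :=
    fun k => hasDerivAt_pi.1 (hasDerivAt_update t i (t i)) k
  have h1 : HasDerivAt (fun s => -x * ∑ r, Function.update t i s r) (-x) (t i) := by
    refine ((HasDerivAt.fun_sum fun r _ => hu r).const_mul (-x)).congr_deriv ?_
    simp
  have h2 : HasDerivAt (fun s => ∑ j, ∑ k ∈ Finset.Ioi j,
      Real.log ((Function.update t i s k - Function.update t i s j) ^ 2 + ε) * (β / 2))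
      (∑ j, ∑ k ∈ Finset.Ioi j, cc β ε t j k *
        ((Pi.single i (1:ℝ) : Fin n → ℝ) k - (Pi.single i (1:ℝ) : Fin n → ℝ) j)) (t i) := by
    refine HasDerivAt.fun_sum fun j _ => HasDerivAt.fun_sum fun k _ => ?_
    refine ((((((hu k).fun_sub (hu j)).fun_pow 2).add_const ε).log (by positivity)).mul_const
      (β / 2)).congr_deriv ?_
    simp only [Function.update_eq_self, cc]
    push_cast
    ring
  have h3 := ((h1.exp.mul h2.exp).mul_const (esS (cv t) (Finset.univ.erase i) q))
  refine (h3.congr_deriv ?_).congr_of_eventuallyEq ?_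
  · simp only [Function.update_eq_self, GG, LD, Vr_eq_exp β ε hε]
    ring
  · refine Filter.Eventually.of_forall fun s => ?_
    simp only [GG, Vr_eq_exp β ε hε, esS_update, Pi.mul_apply]

/-- non-interacting part -/
noncomputable def PP {n : ℕ} (a b x : ℝ) (q : ℕ) (t : Fin n → ℝ) : ℝ :=
  ∑ i, ((a + 1) * (1 - t i) - b * t i - x * (t i * (1 - t i))) * esS (cv t) (Finset.univ.erase i) q

lemma PP_cont {n : ℕ} (a b x : ℝ) (q : ℕ) : Continuous (PP (n := n) a b x q) := by
  have h1 := fun i : Fin n => esS_cont (Finset.univ.erase i) q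
  unfold PP
  fun_prop

lemma PP_eq {n : ℕ} (a b x : ℝ) (q : ℕ) (t : Fin n → ℝ) :
    PP a b x q t = (a + 1 + b - x) * ((q + 1) * esS (cv t) Finset.univ (q + 1))
      - b * ((n - q) * esS (cv t) Finset.univ q)
      + x * ((n - ∑ i, t i) * esS (cv t) Finset.univ (q + 1)
        - (q + 2) * esS (cv t) Finset.univ (q + 2)) := by
  have h1 := esS_I1 (cv t) Finset.univ q
  have h2 := esS_I2 (cv t) Finset.univ q
  have h3 := esS_I3 (cv t) Finset.univ q
  have h4 : ∑ i, cv t i = n - ∑ i, t i := by simp [cv]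
  rw [h4] at h3
  rw [Finset.card_univ, Fintype.card_fin] at h2
  rw [← h1, ← h2, ← h3, Finset.mul_sum, Finset.mul_sum, Finset.mul_sum, ← Finset.sum_sub_distrib,
    ← Finset.sum_add_distrib]
  unfold PP
  refine Finset.sum_congr rfl fun i _ => ?_
  simp only [cv]; ring

lemma pointwise {n : ℕ} (a b β ε x : ℝ) (q : ℕ) (t : Fin n → ℝ) :
    ∑ i, (((a + 1) * (1 - t i) - b * t i) * GG β ε x q i t
      + t i * (1 - t i) * (LD β ε x i t * GG β ε x q i t)) =
    Real.exp (-x * ∑ r, t r) * Vr β ε t * (PP a b x q t + ∑ j, ∑ k ∈ Finset.Ioi j,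
      β * ((t k - t j) ^ 2 / ((t k - t j) ^ 2 + ε)) * Qp (cv t) q j k) := by
  have key : ∑ i, (t i * (1 - t i) * esS (cv t) (Finset.univ.erase i) q) *
      (∑ j, ∑ k ∈ Finset.Ioi j, cc β ε t j k *
    ((Pi.single i (1:ℝ) : Fin n → ℝ) k - (Pi.single i (1:ℝ) : Fin n → ℝ) j)) =
    ∑ j, ∑ k ∈ Finset.Ioi j,
      β * ((t k - t j) ^ 2 / ((t k - t j) ^ 2 + ε)) * Qp (cv t) q j k := by
    simp only [Finset.mul_sum]
    rw [Finset.sum_comm]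
    refine Finset.sum_congr rfl fun j _ => ?_
    rw [Finset.sum_comm]
    refine Finset.sum_congr rfl fun k hk => ?_
    have hjk : j ≠ k := (Finset.mem_Ioi.1 hk).ne
    have hd := Qp_diff (cv t) q j k hjk
    have e : ∀ f : Fin n → ℝ, ∑ i, f i * (cc β ε t j k *
      ((Pi.single i (1:ℝ) : Fin n → ℝ) k - (Pi.single i (1:ℝ) : Fin n → ℝ) j))
        = cc β ε t j k * (f k - f j) := by
      intro f
      have : ∀ i, f i * (cc β ε t j k *
        ((Pi.single i (1:ℝ) : Fin n → ℝ) k - (Pi.single i (1:ℝ) : Fin n → ℝ) j))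
        = cc β ε t j k * ((if k = i then f i else 0) - (if j = i then f i else 0)) := by
        intro i
        simp only [Pi.single_apply]
        split_ifs <;> ring
      rw [Finset.sum_congr rfl fun i _ => this i, ← Finset.mul_sum, Finset.sum_sub_distrib]
      simp
    rw [e]
    have hd' : t k * (1 - t k) * esS (cv t) (Finset.univ.erase k) q
      - t j * (1 - t j) * esS (cv t) (Finset.univ.erase j) q = (t k - t j) * Qp (cv t) q j k := by
      simp only [cv] at hd ⊢
      linear_combination hd
    rw [hd']
    unfold cc
    ring
  rw [← key]
  unfold PP
  rw [← Finset.sum_add_distrib, Finset.mul_sum]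
  refine Finset.sum_congr rfl fun i _ => ?_
  unfold GG LD
  ring

lemma reg_identity {n : ℕ} (a b β : ℝ) (ha : -1 < a) (hb : 0 < b) (hβ : 0 ≤ β) (ε x : ℝ)
    (hε : 0 < ε) (q : ℕ) :
    ∫ t in cube n, wt a b t * (Real.exp (-x * ∑ r, t r) * Vr β ε t *
      (PP a b x q t + ∑ j, ∑ k ∈ Finset.Ioi j,
      β * ((t k - t j) ^ 2 / ((t k - t j) ^ 2 + ε)) * Qp (cv t) q j k)) = 0 := by
  rw [integral_congr_ae (Filter.Eventually.of_forall fun t =>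
    congrArg (fun z => wt a b t * z) (pointwise a b β ε x q t).symm)]
  simp only [Finset.mul_sum]
  have hc : ∀ i : Fin n, Continuous fun t => LD β ε x i t * GG β ε x q i t := fun i =>
    (LD_cont β ε x hε i).mul (GG_cont β ε x hβ q i)
  rw [integral_finsetSum]
  · refine Finset.sum_eq_zero fun i _ => ?_
    exact nD a b ha hb i _ _ (GG_cont β ε x hβ q i) (hc i) (GG_deriv β ε x hε q i)
  · intro i _
    have h1 := hc i
    have h2 := GG_cont β ε x hβ q i
    exact wt_mul_int a b ha hb _ (by fun_prop)

lemma Vr_pair_zero {n : ℕ} (β : ℝ) (hβ : 0 < β) (t : Fin n → ℝ) (j k : Fin n) (hk : j < k)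
    (h : t k - t j = 0) : Vr β 0 t = 0 := by
  unfold Vr
  refine Finset.prod_eq_zero (Finset.mem_univ j) (Finset.prod_eq_zero (Finset.mem_Ioi.2 hk) ?_)
  rw [h]
  have : β / 2 ≠ 0 := by positivity
  simp [Real.zero_rpow this]

open Filter Topology in
lemma lim_identity {n : ℕ} (a b β : ℝ) (ha : -1 < a) (hb : 0 < b) (hβ : 0 ≤ β) (x : ℝ) (q : ℕ) :
    ∫ t in cube n, wt a b t * (Real.exp (-x * ∑ r, t r) * Vr β 0 t *
      (PP a b x q t + ∑ j, ∑ k ∈ Finset.Ioi j, β * Qp (cv t) q j k)) = 0 := by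
  have hQ := fun j k => Qp_cont (n := n) q j k
  have hP := PP_cont (n := n) a b x q
  obtain ⟨C, hC⟩ := IsCompact.exists_bound_of_continuousOn
    (f := fun z : ℝ × (Fin n → ℝ) => Real.exp (-x * ∑ r, z.2 r) * Vr β z.1 z.2 *
      (|PP a b x q z.2| + ∑ j, ∑ k ∈ Finset.Ioi j, β * |Qp (cv z.2) q j k|))
    ((isCompact_Icc (a := (0:ℝ)) (b := 1)).prod (cube_compact n)) (by
      have h1 := Vr_cont (n := n) β hβ
      have h2 : Continuous fun z : ℝ × (Fin n → ℝ) => PP a b x q z.2 := hP.comp continuous_snd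
      have h3 : ∀ j k, Continuous fun z : ℝ × (Fin n → ℝ) => Qp (cv z.2) q j k :=
        fun j k => (hQ j k).comp continuous_snd
      exact Continuous.continuousOn (by fun_prop))
  let e : ℕ → ℝ := fun m => 1 / ((m : ℝ) + 1)
  have he0 : ∀ m, 0 < e m := fun m => by simp only [e]; positivity
  have he1 : ∀ m, e m ≤ 1 := fun m => by
    simp only [e]; rw [div_le_one (by positivity)]; linarith [(Nat.cast_nonneg m : (0:ℝ) ≤ m)]
  have het : Tendsto e atTop (𝓝 0) := tendsto_one_div_add_atTop_nhds_zero_nat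
  have hlim := tendsto_integral_of_dominated_convergence (μ := volume.restrict (cube n))
    (F := fun m t => wt a b t * (Real.exp (-x * ∑ r, t r) * Vr β (e m) t *
      (PP a b x q t + ∑ j, ∑ k ∈ Finset.Ioi j,
      β * ((t k - t j) ^ 2 / ((t k - t j) ^ 2 + e m)) * Qp (cv t) q j k)))
    (f := fun t => wt a b t * (Real.exp (-x * ∑ r, t r) * Vr β 0 t *
      (PP a b x q t + ∑ j, ∑ k ∈ Finset.Ioi j, β * Qp (cv t) q j k)))
    (fun t => ‖wt a b t‖ * C) ?_ ((wt_int a b ha hb).norm.mul_const C) ?_ ?_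
  · simp only [reg_identity a b β ha hb hβ _ x (he0 _) q] at hlim
    exact tendsto_nhds_unique hlim tendsto_const_nhds
  · intro m
    refine (wt_int a b ha hb).aestronglyMeasurable.mul (Continuous.aestronglyMeasurable ?_)
    have h1 := Vr_cont_right (n := n) β (e m) hβ
    have h2 : ∀ j k, Continuous fun t : Fin n → ℝ => (t k - t j) ^ 2 / ((t k - t j) ^ 2 + e m) :=
      fun j k => Continuous.div (by fun_prop) (by fun_prop) fun t =>
        by have := he0 m; positivity
    fun_prop
  · intro m
    filter_upwards [ae_restrict_mem (cube_meas n)] with t ht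
    rw [norm_mul]
    refine mul_le_mul_of_nonneg_left (le_trans ?_ (hC (e m, t) ⟨⟨(he0 m).le, he1 m⟩, ht⟩))
      (norm_nonneg _)
    simp only [norm_mul]
    refine mul_le_mul_of_nonneg_left ?_ (by positivity)
    refine le_trans ?_ (le_abs_self _)
    refine (norm_add_le _ _).trans (add_le_add le_rfl ?_)
    refine (norm_sum_le _ _).trans (Finset.sum_le_sum fun j _ => ?_)
    refine (norm_sum_le _ _).trans (Finset.sum_le_sum fun k _ => ?_)
    rw [Real.norm_eq_abs, abs_mul]
    refine mul_le_mul_of_nonneg_right ?_ (abs_nonneg _)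
    have hpos : 0 < (t k - t j) ^ 2 + e m := by have := he0 m; positivity
    rw [abs_of_nonneg (by positivity)]
    refine mul_le_of_le_one_right hβ ?_
    rw [div_le_one hpos]
    linarith [he0 m]
  · refine Eventually.of_forall fun t => ?_
    refine Tendsto.const_mul _ ?_
    have hV : Tendsto (fun m => Vr β (e m) t) atTop (𝓝 (Vr β 0 t)) :=
      ((Vr_cont_left β t hβ).tendsto 0).comp het
    simp only [mul_assoc]
    refine Tendsto.const_mul _ ?_
    simp only [mul_add, Finset.mul_sum]
    refine (hV.mul_const _).add (tendsto_finsetSum _ fun j _ => tendsto_finsetSum _ fun k hk => ?_)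
    by_cases hu : t k - t j = 0
    · have : Vr β 0 t * (β * Qp (cv t) q j k) = 0 := by
        rcases hβ.eq_or_lt with h | h
        · simp [← h]
        · simp [Vr_pair_zero β h t j k (Finset.mem_Ioi.1 hk) hu]
      rw [this, hu]
      simp
    · have h2 : (t k - t j) ^ 2 ≠ 0 := pow_ne_zero 2 hu
      have : Tendsto (fun m => (t k - t j) ^ 2 / ((t k - t j) ^ 2 + e m)) atTop (𝓝 1) := by
        have := (tendsto_const_nhds (x := (t k - t j) ^ 2) (f := atTop (α := ℕ))).div
          ((tendsto_const_nhds (x := (t k - t j) ^ 2)).add het) (by simpa using h2)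
        rw [add_zero, div_self h2] at this
        exact this
      have := hV.mul ((this.mul_const (Qp (cv t) q j k)).const_mul β)
      simpa using this

/-- unnormalized integrals against a test function -/
noncomputable def JJ {n : ℕ} (a b β x : ℝ) (g : (Fin n → ℝ) → ℝ) : ℝ :=
  ∫ t in cube n, wt a b t * (Real.exp (-x * ∑ r, t r) * Vr β 0 t * g t)

lemma JJ_int {n : ℕ} (a b β : ℝ) (ha : -1 < a) (hb : 0 < b) (hβ : 0 ≤ β) (x : ℝ)
    (g : (Fin n → ℝ) → ℝ) (hg : Continuous g) :
    Integrable (fun t => wt a b t * (Real.exp (-x * ∑ r, t r) * Vr β 0 t * g t))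
      (volume.restrict (cube n)) := by
  have h2 := Vr_cont_right (n := n) β 0 hβ
  exact wt_mul_int a b ha hb _ (by fun_prop)

lemma JJ_add {n : ℕ} (a b β : ℝ) (ha : -1 < a) (hb : 0 < b) (hβ : 0 ≤ β) (x : ℝ)
    (g h : (Fin n → ℝ) → ℝ) (hg : Continuous g) (hh : Continuous h) :
    JJ a b β x (fun t => g t + h t) = JJ a b β x g + JJ a b β x h := by
  unfold JJ
  rw [← integral_add (JJ_int a b β ha hb hβ x g hg) (JJ_int a b β ha hb hβ x h hh)]
  congr 1; ext t; ring

lemma JJ_smul {n : ℕ} (a b β : ℝ) (x c : ℝ)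
    (g : (Fin n → ℝ) → ℝ) :
    JJ a b β x (fun t => c * g t) = c * JJ a b β x g := by
  unfold JJ
  rw [← integral_const_mul]
  congr 1; ext t; ring

lemma JJ_deriv {n : ℕ} (a b β : ℝ) (ha : -1 < a) (hb : 0 < b) (hβ : 0 ≤ β) (x : ℝ)
    (g : (Fin n → ℝ) → ℝ) (hg : Continuous g) :
    HasDerivAt (fun x => JJ a b β x g) (JJ a b β x fun t => -(∑ i, t i) * g t) x := by
  have h2 := Vr_cont_right (n := n) β 0 hβ
  obtain ⟨C, hC⟩ := IsCompact.exists_bound_of_continuousOn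
    (f := fun z : ℝ × (Fin n → ℝ) => Real.exp (-z.1 * ∑ r, z.2 r) * Vr β 0 z.2 *
      (-(∑ i, z.2 i) * g z.2))
    ((isCompact_Icc (a := x - 1) (b := x + 1)).prod (cube_compact n)) (by
      have h1 : Continuous fun z : ℝ × (Fin n → ℝ) => Vr β 0 z.2 := h2.comp continuous_snd
      exact Continuous.continuousOn (by fun_prop))
  unfold JJ
  refine (hasDerivAt_integral_of_dominated_loc_of_deriv_le (s := Set.Icc (x - 1) (x + 1))
    (F' := fun x t => wt a b t * (Real.exp (-x * ∑ r, t r) * Vr β 0 t * (-(∑ i, t i) * g t)))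
    (bound := fun t => ‖wt a b t‖ * C)
    (Icc_mem_nhds (by linarith) (by linarith)) ?_ (JJ_int a b β ha hb hβ x g hg) ?_ ?_
    ((wt_int a b ha hb).norm.mul_const C) ?_).2
  · exact Filter.Eventually.of_forall fun x =>
      (JJ_int a b β ha hb hβ x g hg).aestronglyMeasurable
  · exact (JJ_int a b β ha hb hβ x _ (by fun_prop)).aestronglyMeasurable
  · filter_upwards [ae_restrict_mem (cube_meas n)] with t ht z hz
    rw [norm_mul]
    exact mul_le_mul_of_nonneg_left (hC (z, t) ⟨hz, ht⟩) (norm_nonneg _)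
  · refine Filter.Eventually.of_forall fun t z _ => ?_
    have h1 : HasDerivAt (fun z : ℝ => -z * ∑ r, t r) (-1 * ∑ r, t r) z :=
      (hasDerivAt_id z).neg.mul_const _
    refine (((h1.exp.mul_const (Vr β 0 t)).mul_const (g t)).const_mul (wt a b t)).congr_deriv ?_
    ring

/-- e_p integrals -/
noncomputable def FF (n : ℕ) (a b β : ℝ) (p : ℕ) (x : ℝ) : ℝ :=
  JJ (n := n) a b β x fun t => esS (cv t) Finset.univ p

lemma FF_deriv (n : ℕ) (a b β : ℝ) (ha : -1 < a) (hb : 0 < b) (hβ : 0 ≤ β) (p : ℕ) (x : ℝ) :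
    HasDerivAt (FF n a b β p) (JJ (n := n) a b β x
      fun t => -(∑ i, t i) * esS (cv t) Finset.univ p) x :=
  JJ_deriv a b β ha hb hβ x _ (esS_cont _ _)

lemma selbergH_eq (n : ℕ) (a b β : ℝ) (p : ℕ) :
    selbergH n a b β p = fun x => (1 / (n.choose p : ℝ)) * FF n a b β p x := by
  ext x
  unfold selbergH FF JJ
  congr 1
  refine integral_congr_ae (Filter.Eventually.of_forall fun t => ?_)
  simp only [Vr_zero, wt, esS, cv]
  ring

lemma FF_zero (n : ℕ) (a b β : ℝ) (ha : -1 < a) (hb : 0 < b) (hβ : 0 ≤ β) (x : ℝ) :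
    FF n a b β 1 x = n * FF n a b β 0 x + deriv (FF n a b β 0) x := by
  rw [(FF_deriv n a b β ha hb hβ 0 x).deriv]
  have h0 := esS_cont (n := n) Finset.univ 0
  unfold FF
  rw [← JJ_smul, ← JJ_add a b β ha hb hβ x _ _ (by fun_prop) (by fun_prop)]
  congr 1; ext t
  simp [esS_one, esS_zero, cv]
  ring

lemma FF_succ (n : ℕ) (a b β : ℝ) (ha : -1 < a) (hb : 0 < b) (hβ : 0 ≤ β) (x : ℝ) (q : ℕ) :
    ((a + 1 + b - x + n * x / (q + 1)) * (q + 1) + β / 2 * ((q + 1) * (2 * n - q - 2)))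
        * FF n a b β (q + 1) x
      + -(b * (n - q) + β / 2 * ((n - 1 - q) * (n - q))) * FF n a b β q x
      + x * deriv (FF n a b β (q + 1)) x
      + -(x * (q + 2)) * FF n a b β (q + 2) x = 0 := by
  rw [(FF_deriv n a b β ha hb hβ (q + 1) x).deriv]
  have h0 := esS_cont (n := n) Finset.univ q
  have h1 := esS_cont (n := n) Finset.univ (q + 1)
  have h2 := esS_cont (n := n) Finset.univ (q + 2)
  unfold FF
  simp only [← JJ_smul]
  rw [← JJ_add a b β ha hb hβ x _ _ (by fun_prop) (by fun_prop),
    ← JJ_add a b β ha hb hβ x _ _ (by fun_prop) (by fun_prop),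
    ← JJ_add a b β ha hb hβ x _ _ (by fun_prop) (by fun_prop)]
  rw [← lim_identity (n := n) a b β ha hb hβ x q]
  unfold JJ
  congr 1; ext t; congr 2
  have hQ := Qp_sum (cv t) q
  simp only [← Finset.mul_sum]
  rw [PP_eq]
  have hq : (q : ℝ) + 1 ≠ 0 := by positivity
  have hx : (n : ℝ) * x / (q + 1) * (q + 1) = n * x := by field_simp
  linear_combination (-β / 2) * hQ + (esS (cv t) Finset.univ (q + 1)) * hx

/-- The differential–difference system satisfied by the Selberg correlation integrals:
`(n−p) x Ĥ_{p+1}(x) = ((n−p)x + B̃_p) Ĥ_p(x) + x Ĥ_p′(x) − D̃_p Ĥ_{p−1}(x)`, `p = 0,…,n`. -/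
theorem selbergH_differential_difference_system (n : ℕ) (hn : 1 ≤ n)
    (a b β : ℝ) (ha : -1 < a) (hb : 0 < b) (hβ : 0 ≤ β) :
    ∀ x : ℝ, ∀ p : ℕ, p ≤ n →
      ((n : ℝ) - p) * x * selbergH n a b β (p + 1) x
        = (((n : ℝ) - p) * x + Btil n a b β p) * selbergH n a b β p x
          + x * deriv (selbergH n a b β p) x
          - Dtil n b β p * selbergH n a b β (p - 1) x := by

  intro x p hp
  have hder : deriv (selbergH n a b β p) x = (1 / (n.choose p : ℝ)) * deriv (FF n a b β p) x := by
    rw [selbergH_eq]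
    exact deriv_const_mul _ (FF_deriv n a b β ha hb hβ p x).differentiableAt
  rw [hder]
  simp only [selbergH_eq]
  have hcp : (n.choose p : ℝ) ≠ 0 := by exact_mod_cast (Nat.choose_pos hp).ne'
  have hup : ((n : ℝ) - p) * (1 / (n.choose (p + 1) : ℝ)) * FF n a b β (p + 1) x
      = (1 / (n.choose p : ℝ)) * ((p + 1) * FF n a b β (p + 1) x) := by
    rcases hp.eq_or_lt with h | h
    · subst h
      have : FF p a b β (p + 1) x = 0 := by
        simp [FF, JJ, esS, Finset.powersetCard_eq_empty.2]
      simp [this]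
    · have hc : (n.choose (p + 1) : ℝ) ≠ 0 := by exact_mod_cast (Nat.choose_pos h).ne'
      have hr := congrArg (Nat.cast (R := ℝ)) (Nat.choose_succ_right_eq n p)
      rw [Nat.cast_mul, Nat.cast_mul, Nat.cast_sub hp] at hr
      push_cast at hr
      field_simp
      linear_combination (-FF n a b β (p + 1) x) * hr
  have hL : ((n : ℝ) - p) * x * (1 / (n.choose (p + 1) : ℝ) * FF n a b β (p + 1) x) =
      x * (((n : ℝ) - p) * (1 / (n.choose (p + 1) : ℝ)) * FF n a b β (p + 1) x) := by ring
  rw [hL, hup]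
  cases p with
  | zero =>
    have := FF_zero n a b β ha hb hβ x
    simp [Btil, Dtil, this]
    ring
  | succ q =>
    have hdn : ((q : ℝ) + 1) * (1 / (n.choose q : ℝ)) = (1 / (n.choose (q + 1) : ℝ)) * (n - q) := by
      have hc : (n.choose q : ℝ) ≠ 0 := by exact_mod_cast (Nat.choose_pos (by omega)).ne'
      have hr := congrArg (Nat.cast (R := ℝ)) (Nat.choose_succ_right_eq n q)
      rw [Nat.cast_mul, Nat.cast_mul, Nat.cast_sub (by omega)] at hr
      push_cast at hr
      field_simp
      linear_combination hr
    have hF := FF_succ n a b β ha hb hβ x q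
    have hq : (q : ℝ) + 1 ≠ 0 := by positivity
    have hx : (n : ℝ) * x / (q + 1) * (q + 1) = n * x := by field_simp
    simp only [Btil, Dtil, Nat.add_sub_cancel]
    push_cast
    linear_combination (-(1 / (n.choose (q + 1) : ℝ))) * hF
      + (β / 2 * ((n : ℝ) - (q + 1)) + b) * FF n a b β q x * hdn
      + (1 / (n.choose (q + 1) : ℝ)) * FF n a b β (q + 1) x * hx
end
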